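/- arXiv:math/9802091 — 11 statements merged into one kernel-verified Lean document; each statement's English description precedes it below -/
import Mathlib

section
/- Let (U, ω) be a finite-dimensional complex symplectic vector space and let A ∈ End(U) be ω-self-adjoint. Then for every λ ∈ ℂ and every j ∈ ℕ, the dimension of ker((A − λ·id)^j) is even. In particular, every Jordan block of A occurs with even multiplicity and the characteristic polynomial of A is the square of a polynomial. -/
open Polynomial in
/-- A monic polynomial over an algebraically closed field whose roots all have even multiplicity
is a square. -/
theorem Polynomial.Monic.exists_eq_sq_of_even_rootMultiplicity {K : Type*} [Field K]
    [IsAlgClosed K] {p : K[X]} (hp : p.Monic) (h : ∀ a, Even (p.rootMultiplicity a)) :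
    ∃ q : K[X], p = q ^ 2 := by
  classical
  refine ⟨∏ a ∈ p.roots.toFinset, (X - C a) ^ (p.rootMultiplicity a / 2), ?_⟩
  conv_lhs => rw [(IsAlgClosed.splits p).eq_prod_roots_of_monic hp]
  rw [prod_multiset_root_eq_finset_root, ← Finset.prod_pow]
  refine Finset.prod_congr rfl fun a _ => ?_
  rw [← pow_mul, Nat.div_mul_cancel (h a).two_dvd]

/-- A space carrying a nondegenerate alternating form in characteristic different from two has
even dimension. -/
theorem LinearMap.IsAlt.even_finrank_of_separatingLeft {K V : Type*} [Field K] [NeZero (2 : K)]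
    [AddCommGroup V] [Module K V] [FiniteDimensional K V] {B : V →ₗ[K] V →ₗ[K] K}
    (hB : B.IsAlt) (h : B.SeparatingLeft) : Even (Module.finrank K V) := by
  let b := Module.finBasis K V
  have hdet := (LinearMap.separatingLeft_iff_det_ne_zero b).mp h
  set M := LinearMap.toMatrix₂ b b B with hM
  have hT : M.transpose = -M := by
    ext i j
    simp [hM, LinearMap.toMatrix₂_apply, ← hB.neg (b i) (b j)]
  by_contra hodd
  have hneg : M.det = -M.det := by
    conv_lhs => rw [← Matrix.det_transpose, hT, Matrix.det_neg, Fintype.card_fin,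
      (Nat.not_even_iff_odd.mp hodd).neg_one_pow, neg_one_mul]
  have : (2 : K) * M.det = 0 := by linear_combination hneg
  exact (mul_ne_zero two_ne_zero hdet) this

/-- The kernel of an alternating form in characteristic different from two has even
codimension. -/
theorem LinearMap.IsAlt.even_finrank_range {K V : Type*} [Field K] [NeZero (2 : K)]
    [AddCommGroup V] [Module K V] [FiniteDimensional K V] {B : V →ₗ[K] V →ₗ[K] K}
    (hB : B.IsAlt) : Even (Module.finrank K (LinearMap.range B)) := by
  obtain ⟨W, hW⟩ := Submodule.exists_isCompl (LinearMap.ker B)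
  have hsep : (B.domRestrict₁₂ W W).SeparatingLeft := by
    intro w hw
    have hker : (w : V) ∈ LinearMap.ker B := by
      rw [LinearMap.mem_ker]
      ext v
      obtain ⟨k, hk, w', hw', rfl⟩ := Submodule.mem_sup.mp
        (hW.sup_eq_top ▸ Submodule.mem_top : v ∈ LinearMap.ker B ⊔ W)
      have h₁ : B w k = 0 := by
        rw [← hB.neg, LinearMap.mem_ker.mp hk]
        simp
      have h₂ : B w w' = 0 := hw ⟨w', hw'⟩
      simp [h₁, h₂]
    exact Subtype.ext (Submodule.disjoint_def.mp hW.disjoint _ hker w.2)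
  have hAlt : (B.domRestrict₁₂ W W).IsAlt := fun w => hB w
  have hrank := B.finrank_range_add_finrank_ker
  have hsum := Submodule.finrank_add_eq_of_isCompl hW
  have heven := hAlt.even_finrank_of_separatingLeft hsep
  rwa [show Module.finrank K (LinearMap.range B) = Module.finrank K W by omega]

/-- The kernel of an endomorphism that is self-adjoint for a nondegenerate alternating form has
even dimension. -/
theorem LinearMap.IsAlt.even_finrank_ker_of_isSelfAdjoint {K V : Type*} [Field K]
    [NeZero (2 : K)] [AddCommGroup V] [Module K V] [FiniteDimensional K V]
    {ω : V →ₗ[K] V →ₗ[K] K} (hω : ω.IsAlt) (h : ω.SeparatingLeft) {f : Module.End K V}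
    (hf : ω.IsSelfAdjoint f) : Even (Module.finrank K (LinearMap.ker f)) := by
  have hAlt : (ω ∘ₗ f).IsAlt := by
    intro u
    have h₁ : ω (f u) u = ω u (f u) := hf u u
    have h₂ : -ω (f u) u = ω u (f u) := hω.neg (f u) u
    have h₃ : (2 : K) * ω (f u) u = 0 := by linear_combination h₁ - h₂
    exact (mul_eq_zero.mp h₃).resolve_left two_ne_zero
  have hker : LinearMap.ker (ω ∘ₗ f) = LinearMap.ker f :=
    LinearMap.ker_comp_of_ker_eq_bot f (LinearMap.separatingLeft_iff_ker_eq_bot.mp h)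
  have hrank := (ω ∘ₗ f).finrank_range_add_finrank_ker
  rw [hker] at hrank
  have heven := hω.even_finrank_of_separatingLeft h
  rw [← hrank] at heven
  exact (Nat.even_add.mp heven).mp hAlt.even_finrank_range

theorem stmt_1 (U : Type*) [AddCommGroup U] [Module ℂ U] [FiniteDimensional ℂ U]
    (ω : U →ₗ[ℂ] U →ₗ[ℂ] ℂ)
    (halt : ∀ u, ω u u = 0)
    (hnd : ∀ u, (∀ v, ω u v = 0) → u = 0)
    (A : Module.End ℂ U)
    (hsa : ∀ u v, ω (A u) v = ω u (A v)) :
    -- the dimension of every generalized eigenspace level is even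
    (∀ (lam : ℂ) (j : ℕ),
      Even (Module.finrank ℂ (LinearMap.ker ((A - lam • 1) ^ j)))) ∧
    -- every Jordan block occurs with even multiplicity
    (∀ (lam : ℂ) (j : ℕ), 1 ≤ j →
      Even ((2 * (Module.finrank ℂ (LinearMap.ker ((A - lam • 1) ^ j)) : ℤ)
        - (Module.finrank ℂ (LinearMap.ker ((A - lam • 1) ^ (j - 1))) : ℤ)
        - (Module.finrank ℂ (LinearMap.ker ((A - lam • 1) ^ (j + 1))) : ℤ)))) ∧
    -- the characteristic polynomial is the square of a polynomial
    (∃ q : Polynomial ℂ, LinearMap.charpoly A = q ^ 2) := by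
  have hsub (lam : ℂ) (u v : U) : ω ((A - lam • 1) u) v = ω u ((A - lam • 1) v) := by
    simp [hsa]
  have hpow (lam : ℂ) (j : ℕ) : ω.IsSelfAdjoint ((A - lam • 1) ^ j : Module.End ℂ U) := by
    induction j with
    | zero => exact fun u v => rfl
    | succ j ih =>
      intro u v
      rw [pow_succ, Module.End.mul_apply, ih, hsub, ← Module.End.mul_apply, ← pow_succ',
        ← pow_succ]
  have hker (lam : ℂ) (j : ℕ) :
      Even (Module.finrank ℂ (LinearMap.ker ((A - lam • 1) ^ j))) :=
    LinearMap.IsAlt.even_finrank_ker_of_isSelfAdjoint halt hnd (hpow lam j)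
  refine ⟨hker, fun lam j _ => ?_, ?_⟩
  · exact ((even_two_mul _).sub ((Int.even_coe_nat _).mpr (hker lam _))).sub
      ((Int.even_coe_nat _).mpr (hker lam _))
  · refine A.charpoly_monic.exists_eq_sq_of_even_rootMultiplicity fun a => ?_
    rw [← LinearMap.finrank_maxGenEigenspace_eq,
      Module.End.maxGenEigenspace_eq_genEigenspace_finrank, Module.End.genEigenspace_nat]
    exact hker a _
end

section
/- Let (U, ω) be a complex symplectic vector space of dimension 2n and let A, B ∈ End(U) be nilpotent ω-self-adjoint endomorphisms such that rank(A^j) = rank(B^j) for every j ≥ 1. Then there exists an invertible g ∈ End(U) with ω(g u, g v) = ω(u, v) for all u, v ∈ U (i.e., g ∈ Sp(U, ω)) such that B = g ∘ A ∘ g⁻¹. -/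
namespace Polynomial

/-- Over an algebraically closed field in which `2` is invertible, `X` is a square modulo every
polynomial not vanishing at `0`. -/
theorem exists_dvd_sq_sub_X {K : Type*} [Field K] [IsAlgClosed K] (h2 : (2 : K) ≠ 0) {m : K[X]}
    (h0 : m.eval 0 ≠ 0) : ∃ p : K[X], m ∣ p ^ 2 - X := by
  classical
  have hm0 : m ≠ 0 := by
    rintro rfl
    exact h0 eval_zero
  choose s hs using fun z : K ↦ IsAlgClosed.exists_pow_nat_eq z (n := 2) two_pos
  set q := Lagrange.interpolate m.roots.toFinset id s
  have hq : ∀ z, m.eval z = 0 → q.eval z = s z := fun z hz ↦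
    Lagrange.eval_interpolate_at_node s (v := id) (Set.injOn_id _)
      (by simpa [hm0] using hz : z ∈ m.roots.toFinset)
  have hdvd : m ∣ (q ^ 2 - X) ^ m.natDegree := by
    by_cases hz : (q ^ 2 - X) ^ m.natDegree = 0
    · exact hz ▸ dvd_zero m
    refine (IsAlgClosed.splits m).dvd_of_roots_le_roots hm0 (Multiset.le_iff_count.mpr fun z ↦ ?_)
    by_cases hmz : m.eval z = 0
    · have hne : q ^ 2 - X ≠ 0 := by
        intro h
        have hdeg : (q ^ 2).natDegree = 1 := by rw [sub_eq_zero.mp h, natDegree_X]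
        rw [natDegree_pow] at hdeg
        omega
      have hroot : z ∈ (q ^ 2 - X).roots := by simp [hne, hq z hmz, hs]
      have hcard := (m.roots.count_le_card z).trans m.card_roots'
      rw [roots_pow, Multiset.count_nsmul]
      nlinarith [Multiset.count_pos.mpr hroot]
    · rw [Multiset.count_eq_zero_of_notMem (by simp [hmz])]
      exact Nat.zero_le _
  have hcop : IsCoprime q m := by
    rw [isCoprime_iff_aeval_ne_zero_of_isAlgClosed K K]
    intro z
    by_contra! h
    simp only [coe_aeval_eq_eval] at h
    have hsz := hs z
    rw [← hq z h.2, h.1, zero_pow two_ne_zero] at hsz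
    exact h0 (hsz ▸ h.2)
  have hunit : IsUnit (AdjoinRoot.mk m q) := by
    obtain ⟨u, v, huv⟩ := hcop
    refine IsUnit.of_mul_eq_one (AdjoinRoot.mk m u) ?_
    simpa [mul_comm] using congr(AdjoinRoot.mk m $huv)
  have hunit2 : IsUnit (2 : AdjoinRoot m) := by
    simpa only [map_ofNat] using h2.isUnit.map (algebraMap K (AdjoinRoot m))
  let P : (AdjoinRoot m)[X] := X ^ 2 - C (AdjoinRoot.root m)
  obtain ⟨r, ⟨-, hr⟩, -⟩ := existsUnique_nilpotent_sub_and_aeval_eq_zero (P := P)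
    (x := AdjoinRoot.mk m q)
    ⟨m.natDegree, by simpa [P] using AdjoinRoot.mk_eq_zero.mpr hdvd⟩
    (by simpa [P, one_add_one_eq_two] using hunit2.mul hunit)
  obtain ⟨p, rfl⟩ := AdjoinRoot.mk_surjective r
  exact ⟨p, AdjoinRoot.mk_eq_zero.mp (by simpa [P] using hr)⟩

end Polynomial

open Polynomial in
/-- An integral unit of an algebra over an algebraically closed field in which `2` is invertible has
a square root which is a polynomial in it. -/
theorem IsUnit.exists_aeval_sq_eq {K R : Type*} [Field K] [IsAlgClosed K] (h2 : (2 : K) ≠ 0)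
    [Ring R] [Algebra K R] {a : R} (ha : IsUnit a) (hint : IsIntegral K a) :
    ∃ p : K[X], aeval a p ^ 2 = a := by
  have hm0 := minpoly.ne_zero hint
  have h0 : (minpoly K a).eval 0 ≠ 0 := by
    rw [← coeff_zero_eq_eval_zero]
    intro hc
    obtain ⟨q, hq⟩ := X_dvd_iff.mpr hc
    have hq0 : q ≠ 0 := by
      rintro rfl
      exact hm0 (by rw [hq, mul_zero])
    have haq : a * aeval a q = 0 := by
      have := minpoly.aeval K a
      rwa [hq, map_mul, aeval_X] at this
    have hdeg := natDegree_le_of_dvd (minpoly.dvd K a (ha.mul_right_eq_zero.mp haq)) hq0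
    rw [hq, natDegree_X_mul hq0] at hdeg
    omega
  obtain ⟨p, u, hu⟩ := exists_dvd_sq_sub_X h2 h0
  refine ⟨p, sub_eq_zero.mp ?_⟩
  simpa using congr(aeval a $hu)

namespace LinearMap

variable {K U V : Type*} [Field K] [AddCommGroup U] [Module K U] [AddCommGroup V] [Module K V]

theorem finrank_range_pow_zero (A : Module.End K U) :
    Module.finrank K (range (A ^ 0)) = Module.finrank K U := by
  rw [pow_zero, Module.End.one_eq_id, range_id, finrank_top]

theorem exists_le_ker_disjoint_range [FiniteDimensional K U] (A : Module.End K U) :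
    ∃ C : Submodule K U, C ≤ ker A ∧ Disjoint C (range A) ∧ ker A ≤ range A ⊓ ker A ⊔ C ∧
      Module.finrank K C + 2 * Module.finrank K (range A) =
        Module.finrank K U + Module.finrank K (range (A ^ 2)) := by
  obtain ⟨D, hD⟩ := exists_isCompl (range A ⊓ ker A)
  have hsup : range A ⊓ ker A ⊔ D ⊓ ker A = ker A := by
    rw [← sup_inf_assoc_of_le _ inf_le_right, hD.sup_eq_top, top_inf_eq]
  have hinf : (range A ⊓ ker A) ⊓ (D ⊓ ker A) = ⊥ :=
    le_bot_iff.mp ((inf_le_inf_left _ inf_le_left).trans hD.inf_eq_bot.le)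
  refine ⟨D ⊓ ker A, inf_le_right, ?_, hsup.ge, ?_⟩
  · rw [disjoint_iff, ← le_bot_iff, ← hinf]
    exact fun x hx ↦ ⟨⟨hx.2, hx.1.2⟩, hx.1⟩
  · have h1 := Submodule.finrank_sup_add_finrank_inf_eq (range A ⊓ ker A) (D ⊓ ker A)
    rw [hsup, hinf, finrank_bot] at h1
    have h2 := A.finrank_range_add_finrank_ker
    have h3 := (A.domRestrict (range A)).finrank_range_add_finrank_ker
    have h4 : range (A.domRestrict (range A)) = range (A ^ 2) := by
      ext x
      simp [pow_two]
    have h5 : Module.finrank K (ker (A.domRestrict (range A))) =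
        Module.finrank K ↥(range A ⊓ ker A) := by
      rw [← Submodule.finrank_map_subtype_eq, ker_domRestrict, Submodule.map_comap_subtype]
    rw [h4, h5] at h3
    omega

/-- An intertwining map between the ranges of two endomorphisms extends to one between the whole
spaces. -/
theorem exists_intertwining_extension (A : Module.End K U) (B : Module.End K V)
    (ψ : range A →ₗ[K] range B)
    (hψ : ∀ x : range A, (ψ ⟨A x, mem_range_self A x⟩ : V) = B (ψ x)) :
    ∃ φ : U →ₗ[K] V, (∀ x : range A, φ x = ψ x) ∧ ∀ x, B (φ x) = ψ (A.rangeRestrict x) := by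
  obtain ⟨φ, hφ⟩ := exists_extend ((range B).subtype ∘ₗ ψ)
  replace hφ : ∀ x : range A, φ x = ψ x := fun x ↦ congr($hφ x)
  obtain ⟨σ, hσ⟩ := B.rangeRestrict.exists_rightInverse_of_surjective B.range_rangeRestrict
  replace hσ : ∀ y : range B, B (σ y) = y := fun y ↦ congr((($hσ y : range B) : V))
  obtain ⟨C, hC⟩ := exists_isCompl (range A)
  let π := C.projection (range A) hC.symm
  refine ⟨φ + σ ∘ₗ (ψ ∘ₗ A.rangeRestrict - B.rangeRestrict ∘ₗ φ) ∘ₗ π, fun x ↦ ?_, fun x ↦ ?_⟩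
  · simp [hφ, π]
  · have h1 : x - π x ∈ range A := Submodule.sub_projection_mem hC.symm x
    have h2 : (ψ (A.rangeRestrict (x - π x)) : V) = B (φ (x - π x)) := by
      rw [hφ ⟨_, h1⟩]
      exact hψ ⟨_, h1⟩
    simp only [map_sub, Submodule.coe_sub] at h2
    change B (φ x + σ (ψ (A.rangeRestrict (π x)) - B.rangeRestrict (φ (π x)))) = _
    rw [map_add, hσ, Submodule.coe_sub, codRestrict_apply, ← sub_eq_zero, ← sub_eq_zero.mpr h2.symm]
    abel

theorem exists_linearEquiv_intertwining_of_range [FiniteDimensional K U] [FiniteDimensional K V]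
    (A : Module.End K U) (B : Module.End K V)
    (hrank : ∀ j, Module.finrank K (range (A ^ j)) = Module.finrank K (range (B ^ j)))
    (ψ : range A ≃ₗ[K] range B)
    (hψ : ∀ x : range A, (ψ ⟨A x, mem_range_self A x⟩ : V) = B (ψ x)) :
    ∃ φ : U ≃ₗ[K] V, ∀ x, φ (A x) = B (φ x) := by
  obtain ⟨φ, hφψ, hφ⟩ := exists_intertwining_extension A B ψ.toLinearMap hψ
  obtain ⟨C, hCker, hCdisj, hCsup, hCdim⟩ := exists_le_ker_disjoint_range A
  obtain ⟨D, hDker, hDdisj, -, hDdim⟩ := exists_le_ker_disjoint_range B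
  have hUV : Module.finrank K U = Module.finrank K V := by
    simpa only [finrank_range_pow_zero] using hrank 0
  have hCD : Module.finrank K C = Module.finrank K D := by
    have h1 := hrank 1
    have h2 := hrank 2
    rw [pow_one, pow_one] at h1
    omega
  let θ : C ≃ₗ[K] D := LinearEquiv.ofFinrankEq C D hCD
  obtain ⟨Q, hAQ, hQ⟩ := hCdisj.symm.exists_isCompl
  replace hQ := hQ.symm
  let χ : U →ₗ[K] V := φ ∘ₗ (LinearMap.id - C.projection Q hQ) +
    D.subtype ∘ₗ θ.toLinearMap ∘ₗ C.projectionOnto Q hQ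
  have hχA : ∀ x : range A, χ x = ψ x := fun x ↦ by
    have h1 : C.projection Q hQ x = 0 := (Submodule.projection_apply_eq_zero_iff hQ).mpr (hAQ x.2)
    have h2 : C.projectionOnto Q hQ x = 0 := Subtype.ext h1
    simp [χ, h1, h2, hφψ]
  have hχC : ∀ x : C, χ x = θ x := fun x ↦ by
    simp [χ]
  have hχB : ∀ x, B (χ x) = ψ (A.rangeRestrict x) := fun x ↦ by
    have h1 : B (θ (C.projectionOnto Q hQ x)) = 0 := hDker (θ _).2
    have h2 : A.rangeRestrict (C.projection Q hQ x) = 0 :=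
      Subtype.ext (hCker (Submodule.projection_apply_mem hQ x))
    simp [χ, hφ, h1, h2]
  have hinj : Function.Injective χ := by
    rw [← ker_eq_bot, ker_eq_bot']
    intro x hx
    have h1 : A.rangeRestrict x = 0 := by
      have := hχB x
      rw [hx, map_zero] at this
      simpa using this.symm
    have h2 : x ∈ ker A := congr(($h1 : U))
    obtain ⟨y, hy, z, hz, rfl⟩ := Submodule.mem_sup.mp (hCsup h2)
    rw [map_add, hχA ⟨y, hy.1⟩, hχC ⟨z, hz⟩] at hx
    have h3 : (ψ ⟨y, hy.1⟩ : V) = -(θ ⟨z, hz⟩ : V) := eq_neg_of_add_eq_zero_left hx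
    have h4 : (θ ⟨z, hz⟩ : V) = 0 := by
      refine Submodule.disjoint_def.mp hDdisj _ (θ _).2 ?_
      rw [← neg_mem_iff, ← h3]
      exact (ψ _).2
    rw [h4, neg_zero] at h3
    simp only [ZeroMemClass.coe_eq_zero, LinearEquiv.map_eq_zero_iff, Submodule.mk_eq_zero] at h3 h4
    rw [h3, h4, add_zero]
  refine ⟨LinearEquiv.ofInjectiveOfFinrankEq χ hinj hUV, fun x ↦ ?_⟩
  change χ (A x) = B (χ x)
  rw [hχB]
  exact hχA (A.rangeRestrict x)

theorem IsSelfAdjoint.aeval {M : Type*} [AddCommGroup M] [Module K M] {ω : M →ₗ[K] M →ₗ[K] K}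
    {S : Module.End K M} (hS : ω.IsSelfAdjoint S) (p : Polynomial K) :
    ω.IsSelfAdjoint (Polynomial.aeval S p) := by
  have hpow : ∀ n u v, ω ((S ^ n) u) v = ω u ((S ^ n) v) := fun n ↦ by
    induction n with
    | zero => simp
    | succ n ih =>
      intro u v
      rw [pow_succ, Module.End.mul_apply, ih, hS, ← Module.End.mul_apply, ← pow_succ', pow_succ]
  induction p using Polynomial.induction_on' with
  | add p q hp hq =>
    rw [map_add]
    exact hp.add hq
  | monomial n c =>
    intro u v
    simp [hpow, Polynomial.aeval_monomial, Algebra.algebraMap_eq_smul_one]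

theorem finrank_range_restrict_range_pow (A : Module.End K U) (j : ℕ) :
    Module.finrank K (range ((A.restrict fun x (_ : x ∈ range A) ↦ mem_range_self A x) ^ j)) =
      Module.finrank K (range (A ^ (j + 1))) := by
  rw [← Submodule.finrank_map_subtype_eq]
  have h : Submodule.map (range A).subtype
      (range ((A.restrict fun x (_ : x ∈ range A) ↦ mem_range_self A x) ^ j)) =
        range (A ^ (j + 1)) := by
    have hpow : ∀ y, A ((A ^ j) y) = (A ^ j) (A y) := fun y ↦ by
      rw [← Module.End.mul_apply, ← Module.End.mul_apply, ← pow_succ, pow_succ']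
    have hmem : ∀ x ∈ range A, (A ^ j) x ∈ range A := by
      rintro _ ⟨y, rfl⟩
      exact ⟨(A ^ j) y, hpow y⟩
    rw [Module.End.pow_restrict j _ hmem]
    ext x
    simp only [Submodule.mem_map, mem_range, Subtype.exists, Submodule.subtype_apply, pow_succ,
      Module.End.mul_apply, restrict_apply]
    constructor
    · rintro ⟨_, _, ⟨_, ⟨y, rfl⟩, h⟩, rfl⟩
      exact ⟨y, congr(($h : U))⟩
    · rintro ⟨y, rfl⟩
      exact ⟨_, ⟨_, hpow y⟩, ⟨_, ⟨y, rfl⟩, rfl⟩, rfl⟩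
  rw [h]

/-- Nilpotent endomorphisms whose powers have the same ranks are conjugate. -/
theorem exists_linearEquiv_intertwining_of_finrank_range_pow_eq {K : Type*} [Field K] {k : ℕ} :
    ∀ {U V : Type*} [AddCommGroup U] [Module K U] [FiniteDimensional K U]
      [AddCommGroup V] [Module K V] [FiniteDimensional K V]
      (A : Module.End K U) (B : Module.End K V), A ^ k = 0 →
      (∀ j, Module.finrank K (range (A ^ j)) = Module.finrank K (range (B ^ j))) →
      ∃ φ : U ≃ₗ[K] V, ∀ x, φ (A x) = B (φ x) := by
  induction k with
  | zero =>
    intro U V _ _ _ _ _ _ A B hA hrank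
    have hU : ∀ x : U, x = 0 := fun x ↦ by simpa using congr($hA x)
    have : Subsingleton U := ⟨fun x y ↦ by rw [hU x, hU y]⟩
    have hUV : Module.finrank K U = Module.finrank K V := by
      simpa only [finrank_range_pow_zero] using hrank 0
    refine ⟨LinearEquiv.ofFinrankEq U V hUV, fun x ↦ ?_⟩
    rw [hU x]
    simp
  | succ k ih =>
    intro U V _ _ _ _ _ _ A B hA hrank
    obtain ⟨ψ, hψ⟩ := ih (A.restrict fun x _ ↦ mem_range_self A x)
      (B.restrict fun x _ ↦ mem_range_self B x) (by
        ext ⟨_, y, rfl⟩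
        rw [Module.End.pow_restrict]
        simpa [pow_succ] using congr($hA y)) (fun j ↦ by
        rw [finrank_range_restrict_range_pow, finrank_range_restrict_range_pow, hrank])
    exact exists_linearEquiv_intertwining_of_range A B hrank ψ fun x ↦ congr(($(hψ x) : V))

end LinearMap


theorem stmt_2 (n : ℕ) (U : Type*) [AddCommGroup U] [Module ℂ U] [FiniteDimensional ℂ U]
    (hdim : Module.finrank ℂ U = 2 * n)
    (ω : U →ₗ[ℂ] U →ₗ[ℂ] ℂ)
    (halt : ∀ u, ω u u = 0)
    (hnd : ∀ u, (∀ v, ω u v = 0) → u = 0)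
    (A B : Module.End ℂ U)
    (hAnil : IsNilpotent A) (hBnil : IsNilpotent B)
    (hAsa : ∀ u v, ω (A u) v = ω u (A v))
    (hBsa : ∀ u v, ω (B u) v = ω u (B v))
    (hrank : ∀ j : ℕ, 1 ≤ j →
      Module.finrank ℂ (LinearMap.range (A ^ j)) =
        Module.finrank ℂ (LinearMap.range (B ^ j))) :
    ∃ g : U ≃ₗ[ℂ] U, (∀ u v, ω (g u) (g v) = ω u v) ∧
      B = g.toLinearMap ∘ₗ A ∘ₗ g.symm.toLinearMap := by
  obtain ⟨k, hk⟩ := hAnil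
  obtain ⟨h, hh⟩ := LinearMap.exists_linearEquiv_intertwining_of_finrank_range_pow_eq A B hk
    fun j ↦ by
      obtain rfl | hj := Nat.eq_zero_or_pos j
      · rw [pow_zero, pow_zero]
      · exact hrank j hj
  have hskew : ∀ u v, ω u v = -ω v u := fun u v ↦ (LinearMap.IsAlt.neg halt v u).symm
  have hinjω : Function.Injective ω := by
    rw [← LinearMap.ker_eq_bot, LinearMap.ker_eq_bot']
    exact fun u hu ↦ hnd u fun v ↦ by rw [hu, LinearMap.zero_apply]
  have hext : ∀ {u u'}, (∀ v, ω u v = ω u' v) → u = u' := fun huu' ↦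
    hinjω (LinearMap.ext huu')
  let Ω : U ≃ₗ[ℂ] Module.Dual ℂ U :=
    LinearEquiv.ofInjectiveOfFinrankEq ω hinjω Subspace.dual_finrank_eq.symm
  let S : Module.End ℂ U := Ω.symm.toLinearMap ∘ₗ ω.compl₁₂ h.toLinearMap h.toLinearMap
  have hS : ∀ u v, ω (S u) v = ω (h u) (h v) := fun u v ↦
    congr($(Ω.apply_symm_apply (ω.compl₁₂ h.toLinearMap h.toLinearMap u)) v)
  have hSinj : Function.Injective S := by
    rw [← LinearMap.ker_eq_bot, LinearMap.ker_eq_bot']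
    refine fun u hu ↦ h.map_eq_zero_iff.mp (hnd _ fun v ↦ ?_)
    rw [← h.apply_symm_apply v, ← hS, hu, map_zero, LinearMap.zero_apply]
  have hSunit : IsUnit S := (LinearMap.isUnit_iff_ker_eq_bot S).mpr (LinearMap.ker_eq_bot.mpr hSinj)
  have hSsa : ∀ u v, ω (S u) v = ω u (S v) := fun u v ↦ by
    rw [hS, hskew, ← hS, ← hskew]
  have hSA : Commute A S := LinearMap.ext fun u ↦ hext fun v ↦ by
    simp only [Module.End.mul_apply]
    rw [hAsa, hS, hS, hh, hh, hBsa]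
  obtain ⟨p, hp⟩ := hSunit.exists_aeval_sq_eq (K := ℂ) two_ne_zero
    (Algebra.IsIntegral.isIntegral S)
  set T := Polynomial.aeval S p
  have hTA : Commute A T :=
    Algebra.commute_of_mem_adjoin_singleton_of_commute
      (Polynomial.aeval_mem_adjoin_singleton ℂ S) hSA
  have hTsa : ∀ u v, ω (T u) v = ω u (T v) := LinearMap.IsSelfAdjoint.aeval hSsa p
  have hTunit : IsUnit T := (isUnit_pow_iff two_ne_zero).mp (hp ▸ hSunit)
  let t : U ≃ₗ[ℂ] U := LinearEquiv.ofBijective T ((Module.End.isUnit_iff T).mp hTunit)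
  have ht : ∀ u, T (t.symm u) = u := t.apply_symm_apply
  refine ⟨t.symm.trans h, fun u v ↦ ?_, LinearMap.ext fun u ↦ ?_⟩
  · change ω (h (t.symm u)) (h (t.symm v)) = ω u v
    rw [← hS, ← hp, pow_two, Module.End.mul_apply, hTsa, ht, ht]
  · change B u = h (t.symm (A (t (h.symm u))))
    have h1 : A (t (h.symm u)) = t (A (h.symm u)) := congr($hTA (h.symm u))
    rw [h1, t.symm_apply_apply, hh, h.apply_symm_apply]
end

section
/- Let n = n_1 + ⋯ + n_k be a partition of n and let (U, ω) be a complex symplectic vector space of dimension 2n. Then there exists a nilpotent ω-self-adjoint endomorphism A of U whose Jordan block sizes are n_1, n_1, n_2, n_2, …, n_k, n_k (each part of the partition occurring twice). -/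
/-- A nonzero dual pairing forces linear independence. -/
theorem linearIndependent_of_pairing {K U ι : Type*} [Field K] [AddCommGroup U] [Module K U]
    [Fintype ι] (ω : U →ₗ[K] U →ₗ[K] K) (v w : ι → U)
    (hne : ∀ x, ω (v x) (w x) ≠ 0) (hzero : ∀ x y, x ≠ y → ω (v x) (w y) = 0) :
    LinearIndependent K v := by
  rw [Fintype.linearIndependent_iff]
  intro g hg y
  have h := congrArg (fun u => ω u (w y)) hg
  simp only [map_sum, map_smul, LinearMap.sum_apply, LinearMap.smul_apply, map_zero,
    LinearMap.zero_apply, smul_eq_mul] at h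
  rw [Finset.sum_eq_single y (fun x _ hx => by rw [hzero x y hx, mul_zero]) (by simp)] at h
  exact (mul_eq_zero.mp h).resolve_right (hne y)

/-- Symplectic families of every size up to half the dimension. -/
theorem exists_symplectic_family {K U : Type*} [Field K] [AddCommGroup U] [Module K U]
    [FiniteDimensional K U] (ω : U →ₗ[K] U →ₗ[K] K) (halt : ω.IsAlt)
    (hnd : ∀ u, (∀ v, ω u v = 0) → u = 0) (m : ℕ) (hm : 2 * m ≤ Module.finrank K U) :
    ∃ e f : Fin m → U, (∀ i j, ω (e i) (e j) = 0) ∧ (∀ i j, ω (f i) (f j) = 0) ∧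
      ∀ i j, ω (e i) (f j) = if i = j then 1 else 0 := by
  induction m with
  | zero => exact ⟨Fin.elim0, Fin.elim0, fun i => i.elim0, fun i => i.elim0, fun i => i.elim0⟩
  | succ m ih =>
    obtain ⟨e, f, hee, hff, hef⟩ := ih (by omega)
    have hfe : ∀ i j, ω (f i) (e j) = if i = j then -1 else 0 := by
      intro i j
      rw [← halt.neg, hef]
      by_cases h : i = j
      · simp [h]
      · simp [h, Ne.symm h]
    let φ : U →ₗ[K] (Fin m ⊕ Fin m → K) :=
      LinearMap.pi (fun x => ω.flip (Sum.elim e f x))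
    obtain ⟨u, hu, hu0⟩ : ∃ u ∈ LinearMap.ker φ, u ≠ 0 := by
      refine Submodule.exists_mem_ne_zero_of_ne_bot (LinearMap.ker_ne_bot_of_finrank_lt ?_)
      simp
      omega
    have hue : ∀ i, ω u (e i) = 0 := fun i => congrFun hu (Sum.inl i)
    have huf : ∀ i, ω u (f i) = 0 := fun i => congrFun hu (Sum.inr i)
    have heu : ∀ i, ω (e i) u = 0 := fun i => by rw [← halt.neg, hue, neg_zero]
    have hfu : ∀ i, ω (f i) u = 0 := fun i => by rw [← halt.neg, huf, neg_zero]
    obtain ⟨v, hv⟩ : ∃ v, ω u v ≠ 0 := by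
      by_contra! h
      exact hu0 (hnd u h)
    let w : U := (ω u v)⁻¹ • v
    let z : U := w - ∑ i, ω (e i) w • f i + ∑ i, ω (f i) w • e i
    have huz : ω u z = 1 := by
      simp [z, w, hue, huf, hv]
    have hez : ∀ i, ω (e i) z = 0 := by
      intro i
      simp [z, hee, hef]
    have hfz : ∀ i, ω (f i) z = 0 := by
      intro i
      simp [z, hff, hfe]
    have hze : ∀ i, ω z (e i) = 0 := fun i => by rw [← halt.neg, hez, neg_zero]
    have hzf : ∀ i, ω z (f i) = 0 := fun i => by rw [← halt.neg, hfz, neg_zero]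
    refine ⟨Fin.cons u e, Fin.cons z f, ?_, ?_, ?_⟩ <;> intro i j <;>
      cases i using Fin.cases <;> cases j using Fin.cases <;>
      simp [hee, hff, hef, hue, heu, hzf, hfz, huz, huf, hez, halt.self_eq_zero,
        (Fin.succ_ne_zero _).symm]

section ShiftOperator

variable {K U P : Type*} [Field K] [AddCommGroup U] [Module K U] {m : P → ℕ}
  (b : Module.Basis (Σ p, Fin (m p)) K U) (A : Module.End K U)

/-- The powers of a shift along the chains of a basis. -/
theorem shift_pow_apply
    (hA : ∀ p t, A (b ⟨p, t⟩) = if h : t.1 + 1 < m p then b ⟨p, ⟨t.1 + 1, h⟩⟩ else 0)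
    (j : ℕ) (p : P) (t : Fin (m p)) :
    (A ^ j) (b ⟨p, t⟩) = if h : t.1 + j < m p then b ⟨p, ⟨t.1 + j, h⟩⟩ else 0 := by
  induction j with
  | zero => simp
  | succ j ih =>
    rw [pow_succ', Module.End.mul_apply, ih]
    by_cases h : t.1 + j < m p
    · rw [dif_pos h, hA]
      rfl
    · rw [dif_neg h, map_zero, dif_neg (by omega)]

theorem isNilpotent_of_shift [Fintype P]
    (hA : ∀ p t, A (b ⟨p, t⟩) = if h : t.1 + 1 < m p then b ⟨p, ⟨t.1 + 1, h⟩⟩ else 0) :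
    IsNilpotent A := by
  refine ⟨∑ p, m p, b.ext ?_⟩
  rintro ⟨p, t⟩
  have := Finset.single_le_sum (f := m) (fun _ _ => Nat.zero_le _) (Finset.mem_univ p)
  rw [shift_pow_apply b A hA, dif_neg (by omega), LinearMap.zero_apply]

theorem range_shift_pow
    (hA : ∀ p t, A (b ⟨p, t⟩) = if h : t.1 + 1 < m p then b ⟨p, ⟨t.1 + 1, h⟩⟩ else 0) (j : ℕ) :
    LinearMap.range (A ^ j) = Submodule.span K
      (Set.range fun x : Σ p, {t : Fin (m p) // j ≤ t.1} => b ⟨x.1, x.2.1⟩) := by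
  rw [LinearMap.range_eq_map, ← b.span_eq, Submodule.map_span]
  apply le_antisymm <;> rw [Submodule.span_le]
  · rintro _ ⟨_, ⟨⟨p, t⟩, rfl⟩, rfl⟩
    rw [shift_pow_apply b A hA]
    split_ifs with h
    · exact Submodule.subset_span ⟨⟨p, ⟨⟨t.1 + j, h⟩, Nat.le_add_left _ _⟩⟩, rfl⟩
    · exact Submodule.zero_mem _
  · rintro _ ⟨⟨p, ⟨t, ht⟩⟩, rfl⟩
    refine Submodule.subset_span ⟨_, ⟨⟨p, ⟨t.1 - j, by omega⟩⟩, rfl⟩, ?_⟩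
    rw [shift_pow_apply b A hA, dif_pos (by simp only; omega)]
    congr 3
    simp only
    omega

theorem finrank_range_shift_pow [Fintype P]
    (hA : ∀ p t, A (b ⟨p, t⟩) = if h : t.1 + 1 < m p then b ⟨p, ⟨t.1 + 1, h⟩⟩ else 0) (j : ℕ) :
    Module.finrank K (LinearMap.range (A ^ j)) = ∑ p, (m p - j) := by
  rw [range_shift_pow b A hA, finrank_span_eq_card]
  · rw [Fintype.card_sigma]
    refine Finset.sum_congr rfl fun p _ => ?_
    rw [Fintype.card_subtype]
    have : (Finset.univ.filter fun t : Fin (m p) => t.1 < j).card = min (m p) j :=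
      Fin.card_filter_val_lt
    have h2 := Finset.card_filter_add_card_filter_not (s := (Finset.univ : Finset (Fin (m p))))
      (fun t => t.1 < j)
    simp only [not_lt, Finset.card_univ, Fintype.card_fin] at h2
    omega
  · refine b.linearIndependent.comp (fun x : Σ p, {t : Fin (m p) // j ≤ t.1} =>
      (⟨x.1, x.2.1⟩ : Σ p, Fin (m p))) ?_
    rintro ⟨p, s, hs⟩ ⟨q, t, ht⟩ h
    obtain ⟨rfl, h⟩ := Sigma.mk.inj_iff.mp h
    obtain rfl := eq_of_heq h
    rfl

end ShiftOperator

theorem sum_tsub_pred_tsub_sum_tsub {P : Type*} [Fintype P] (m : P → ℕ) {j : ℕ} (hj : 1 ≤ j) :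
    ∑ p, (m p - (j - 1)) - ∑ p, (m p - j) = (Finset.univ.filter (fun p => j ≤ m p)).card := by
  rw [Finset.card_filter, Nat.sub_eq_iff_eq_add
    (Finset.sum_le_sum fun p _ => by omega), ← Finset.sum_add_distrib]
  refine Finset.sum_congr rfl fun p _ => ?_
  split_ifs <;> omega

/-- A space with a symplectic form of dimension twice `∑ i, n i` has a basis made of pairs of chains
of lengths `n i`, each chain pairing with the reversal of its partner. -/
theorem exists_chain_basis {K U ι : Type*} [Field K] [AddCommGroup U] [Module K U]
    [FiniteDimensional K U] [Fintype ι] [DecidableEq ι] (n : ι → ℕ)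
    (hdim : Module.finrank K U = 2 * ∑ i, n i)
    (ω : U →ₗ[K] U →ₗ[K] K) (halt : ω.IsAlt) (hnd : ∀ u, (∀ v, ω u v = 0) → u = 0) :
    ∃ b : Module.Basis (Σ p : ι × Bool, Fin (n p.1)) K U,
      ∀ i s t i' s' t', ω (b ⟨(i, s), t⟩) (b ⟨(i', s'), t'⟩) =
        if i = i' ∧ t.1 + t'.1 + 1 = n i then
          (if s = s' then 0 else if s then -1 else 1) else 0 := by
  obtain ⟨e, f, hee, hff, hef⟩ := exists_symplectic_family ω halt hnd (∑ i, n i) hdim.ge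
  have hfe : ∀ i j, ω (f i) (e j) = if i = j then -1 else 0 := by
    intro i j
    rw [← halt.neg, hef]
    by_cases h : i = j
    · simp [h]
    · simp [h, Ne.symm h]
  let σ : (Σ i, Fin (n i)) ≃ Fin (∑ i, n i) := Fintype.equivFinOfCardEq (by simp)
  let v : (Σ p : ι × Bool, Fin (n p.1)) → U := fun x =>
    if x.1.2 then f (σ ⟨x.1.1, x.2.rev⟩) else e (σ ⟨x.1.1, x.2⟩)
  have hrev : ∀ i (t : Fin (n i)) i' (t' : Fin (n i')),
      (⟨i, t⟩ : Σ i, Fin (n i)) = ⟨i', t'.rev⟩ ↔ i = i' ∧ t.1 + t'.1 + 1 = n i := by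
    intro i t i' t'
    by_cases h : i = i'
    · subst h
      simp only [Sigma.mk.injEq, heq_eq_eq, true_and, Fin.ext_iff, Fin.val_rev]
      omega
    · simp [h]
  have hrev' : ∀ i (t : Fin (n i)) i' (t' : Fin (n i')),
      (⟨i, t.rev⟩ : Σ i, Fin (n i)) = ⟨i', t'⟩ ↔ i = i' ∧ t.1 + t'.1 + 1 = n i := by
    intro i t i' t'
    by_cases h : i = i'
    · subst h
      simp only [Sigma.mk.injEq, heq_eq_eq, true_and, Fin.ext_iff, Fin.val_rev]
      omega
    · simp [h]
  have hv : ∀ i s t i' s' t', ω (v ⟨(i, s), t⟩) (v ⟨(i', s'), t'⟩) =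
        if i = i' ∧ t.1 + t'.1 + 1 = n i then
          (if s = s' then 0 else if s then -1 else 1) else 0 := by
    intro i s t i' s' t'
    cases s <;> cases s' <;> simp [v, hee, hff, hef, hfe, hrev, hrev']
  have hli : LinearIndependent K v := by
    refine linearIndependent_of_pairing ω v (fun x => v ⟨(x.1.1, !x.1.2), x.2.rev⟩) ?_ ?_
    · rintro ⟨⟨i, s⟩, t⟩
      rw [hv, if_pos ⟨rfl, by simp only [Fin.val_rev]; omega⟩]
      cases s <;> simp
    · rintro ⟨⟨i, s⟩, t⟩ ⟨⟨i', s'⟩, t'⟩ hne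
      rw [hv]
      by_cases h : i = i' ∧ t.1 + t'.rev.1 + 1 = n i
      · rw [if_pos h]
        obtain ⟨rfl, h⟩ := h
        have ht' : t'.1 < n i := t'.isLt
        obtain rfl : t = t' := by
          apply Fin.ext
          rw [Fin.val_rev] at h
          dsimp only at h
          omega
        cases s <;> cases s' <;> first | rfl | exact absurd rfl hne
      · exact if_neg h
  have hcard : Fintype.card (Σ p : ι × Bool, Fin (n p.1)) = Module.finrank K U := by
    rw [hdim, Fintype.card_sigma, Fintype.sum_prod_type]
    simp [Finset.mul_sum, two_mul]
  refine ⟨basisOfLinearIndependentOfCardEqFinrank' v hli hcard, ?_⟩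
  simpa using hv


theorem stmt_3 (k : ℕ) (npart : Fin k → ℕ) (hpos : ∀ i, 0 < npart i)
    (U : Type*) [AddCommGroup U] [Module ℂ U] [FiniteDimensional ℂ U]
    (hdim : Module.finrank ℂ U = 2 * ∑ i, npart i)
    (ω : U →ₗ[ℂ] U →ₗ[ℂ] ℂ)
    (halt : ∀ u, ω u u = 0)
    (hnd : ∀ u, (∀ v, ω u v = 0) → u = 0) :
    ∃ A : Module.End ℂ U,
      IsNilpotent A ∧
      (∀ u v, ω (A u) v = ω u (A v)) ∧
      -- the Jordan block sizes of `A` are `n_1, n_1, n_2, n_2, …, n_k, n_k`: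
      -- for every `j ≥ 1`, the number of Jordan blocks of size `≥ j` equals
      -- `rank A^(j-1) - rank A^j`
      (∀ j : ℕ, 1 ≤ j →
        Module.finrank ℂ (LinearMap.range (A ^ (j - 1))) -
          Module.finrank ℂ (LinearMap.range (A ^ j)) =
        2 * (Finset.univ.filter (fun i => j ≤ npart i)).card) := by
  obtain ⟨b, hb⟩ := exists_chain_basis npart hdim ω halt hnd
  let A : Module.End ℂ U := b.constr ℂ fun x =>
    if h : x.2.1 + 1 < npart x.1.1 then b ⟨x.1, ⟨x.2.1 + 1, h⟩⟩ else 0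
  have hA : ∀ p t, A (b ⟨p, t⟩) =
      if h : t.1 + 1 < npart p.1 then b ⟨p, ⟨t.1 + 1, h⟩⟩ else 0 :=
    fun p t => b.constr_basis ℂ _ _
  refine ⟨A, isNilpotent_of_shift b A hA, ?_, ?_⟩
  · have key : ω ∘ₗ A = ω.compl₂ A := by
      refine LinearMap.ext_basis b b ?_
      rintro ⟨⟨i, s⟩, t⟩ ⟨⟨i', s'⟩, t'⟩
      simp only [LinearMap.comp_apply, LinearMap.compl₂_apply, hA]
      by_cases hi : i = i'
      · subst hi
        have h3 : t.1 + 1 + t'.1 + 1 = t.1 + (t'.1 + 1) + 1 := by omega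
        split_ifs with h h' h'
        · simp only [hb, h3]
        · rw [hb, if_neg (by simp only; omega), map_zero]
        · rw [hb, if_neg (by simp only; omega), map_zero, LinearMap.zero_apply]
        · simp
      · split_ifs <;> simp [hb, hi]
    exact fun u v => LinearMap.congr_fun₂ key u v
  · intro j hj
    rw [finrank_range_shift_pow b A hA, finrank_range_shift_pow b A hA,
      sum_tsub_pred_tsub_sum_tsub _ hj, Finset.card_filter, Fintype.sum_prod_type,
      Finset.card_filter, Finset.mul_sum]
    simp only [Fintype.sum_bool, two_mul]
end

section
/- Let n = n_1 + ⋯ + n_k be a partition of n. Then there exists a nilpotent complex symmetric matrix A ∈ M_n(ℂ) (i.e., Aᵀ = A and A^n = 0) whose Jordan block sizes are exactly n_1, …, n_k. -/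
open Matrix in
/-- If `P` is a symmetric involution with `P * J * P = Jᵀ`, then `J` is similar to a complex
symmetric matrix, through a conjugation by `1 + I • P`. -/
theorem exists_symmetric_conj {m : Type*} [Fintype m] [DecidableEq m] (J P : Matrix m m ℂ)
    (hP : Pᵀ = P) (hPP : P * P = 1) (hJ : P * J * P = Jᵀ) :
    ∃ U V : Matrix m m ℂ, U * V = 1 ∧ V * U = 1 ∧ (U * J * V)ᵀ = U * J * V := by
  have hI : Complex.I * Complex.I = -1 := Complex.I_mul_I
  have hPJ : Jᵀ * P = P * J := by
    rw [← hJ, Matrix.mul_assoc, hPP, Matrix.mul_one]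
  have hJP : P * Jᵀ = J * P := by
    rw [← hJ, ← Matrix.mul_assoc, ← Matrix.mul_assoc, hPP, Matrix.one_mul]
  refine ⟨1 + Complex.I • P, (1 / 2 : ℂ) • (1 - Complex.I • P), ?_, ?_, ?_⟩
  · simp only [mul_smul_comm, add_mul, mul_sub, smul_mul_assoc, hPP, mul_one, one_mul]
    match_scalars <;> first | ring1 | linear_combination (-1 / 2 : ℂ) * hI
  · simp only [mul_smul_comm, sub_mul, mul_add, smul_mul_assoc, hPP, mul_one, one_mul]
    match_scalars <;> first | ring1 | linear_combination (-1 / 2 : ℂ) * hI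
  · have key : (1 + Complex.I • P) * J * ((1 / 2 : ℂ) • (1 - Complex.I • P)) =
        (1 / 2 : ℂ) • (J + Jᵀ + Complex.I • (P * J) - Complex.I • (J * P)) := by
      simp only [mul_smul_comm, add_mul, mul_sub, smul_mul_assoc, mul_one, one_mul, smul_smul,
        smul_sub, smul_add, hJ]
      match_scalars <;> first | ring1 | linear_combination (-1 / 2 : ℂ) * hI
    rw [key]
    simp only [transpose_smul, transpose_sub, transpose_add, transpose_mul, transpose_transpose,
      hP, hPJ, hJP]
    module

section JordanShift

variable {ι : Type*} (p : ι → ℕ)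

theorem sigma_fin_ext {x y : (i : ι) × Fin (p i)} (h : x.1 = y.1) (h' : (x.2 : ℕ) = y.2) :
    x = y := by
  obtain ⟨i, a⟩ := x
  obtain ⟨j, b⟩ := y
  obtain rfl : i = j := h
  obtain rfl : a = b := Fin.ext h'
  rfl

variable [DecidableEq ι]

/-- The `m`-th power of the nilpotent Jordan matrix with blocks of sizes `p i`. -/
def jordanShift (m : ℕ) : Matrix ((i : ι) × Fin (p i)) ((i : ι) × Fin (p i)) ℂ :=
  fun x y => if x.1 = y.1 ∧ (x.2 : ℕ) + m = y.2 then 1 else 0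

/-- The matrix reversing the basis of each block. -/
def blockReversal : Matrix ((i : ι) × Fin (p i)) ((i : ι) × Fin (p i)) ℂ :=
  fun x y => if x.1 = y.1 ∧ (x.2 : ℕ) + y.2 + 1 = p x.1 then 1 else 0

theorem jordanShift_zero : jordanShift p 0 = 1 := by
  ext x y
  rw [jordanShift, Matrix.one_apply]
  refine if_congr ⟨fun h => sigma_fin_ext p h.1 (by simpa using h.2), ?_⟩ rfl rfl
  rintro rfl
  simp

theorem jordanShift_eq_zero {m : ℕ} (h : ∀ i, p i ≤ m) : jordanShift p m = 0 := by
  ext x y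
  rw [jordanShift, if_neg, Matrix.zero_apply]
  rintro ⟨-, h2⟩
  have := y.2.isLt
  have := h y.1
  omega

theorem blockReversal_transpose : (blockReversal p).transpose = blockReversal p := by
  ext ⟨i, a⟩ ⟨j, b⟩
  simp only [Matrix.transpose_apply, blockReversal]
  refine if_congr ⟨?_, ?_⟩ rfl rfl <;>
  · rintro ⟨rfl, h⟩
    exact ⟨rfl, by omega⟩

variable [Fintype ι]

theorem jordanShift_mul_apply (m : ℕ) (M : Matrix ((i : ι) × Fin (p i)) ((i : ι) × Fin (p i)) ℂ)
    (x y : (i : ι) × Fin (p i)) :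
    (jordanShift p m * M) x y =
      if h : (x.2 : ℕ) + m < p x.1 then M ⟨x.1, ⟨x.2 + m, h⟩⟩ y else 0 := by
  rw [Matrix.mul_apply]
  split_ifs with h
  · rw [Finset.sum_eq_single ⟨x.1, ⟨x.2 + m, h⟩⟩]
    · simp [jordanShift]
    · intro z _ hz
      rw [jordanShift, if_neg, zero_mul]
      exact fun hxz => hz (sigma_fin_ext p hxz.1.symm hxz.2.symm)
    · simp
  · refine Finset.sum_eq_zero fun z _ => ?_
    rw [jordanShift, if_neg, zero_mul]
    rintro ⟨h1, h2⟩
    exact h (h2.trans_lt (z.2.isLt.trans_eq (congrArg p h1.symm)))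

theorem blockReversal_mul_apply (M : Matrix ((i : ι) × Fin (p i)) ((i : ι) × Fin (p i)) ℂ)
    (x y : (i : ι) × Fin (p i)) :
    (blockReversal p * M) x y = M ⟨x.1, x.2.rev⟩ y := by
  have hx := x.2.isLt
  rw [Matrix.mul_apply, Finset.sum_eq_single ⟨x.1, x.2.rev⟩]
  · rw [blockReversal, if_pos ⟨rfl, by simp only [Fin.val_rev]; omega⟩, one_mul]
  · intro z _ hz
    rw [blockReversal, if_neg, zero_mul]
    exact fun hxz => hz (sigma_fin_ext p hxz.1.symm
      (by have := hxz.2; simp only [Fin.val_rev]; omega))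
  · simp

theorem blockReversal_mul_self : blockReversal p * blockReversal p = 1 := by
  ext ⟨i, a⟩ ⟨j, b⟩
  rw [blockReversal_mul_apply, blockReversal, Matrix.one_apply]
  refine if_congr ⟨?_, ?_⟩ rfl rfl
  · rintro ⟨h1, h2⟩
    exact sigma_fin_ext p h1 (by have := a.isLt; simp only [Fin.val_rev] at h2 ⊢; omega)
  · rintro h
    cases h
    exact ⟨rfl, by have := a.isLt; simp only [Fin.val_rev]; omega⟩

theorem blockReversal_conj_jordanShift (m : ℕ) :
    blockReversal p * jordanShift p m * blockReversal p = (jordanShift p m).transpose := by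
  have h : jordanShift p m * blockReversal p = blockReversal p * (jordanShift p m).transpose := by
    ext ⟨i, a⟩ ⟨j, b⟩
    have ha := a.isLt
    have hb := b.isLt
    rw [jordanShift_mul_apply, blockReversal_mul_apply, Matrix.transpose_apply]
    simp only [blockReversal, jordanShift, Fin.val_rev]
    by_cases hij : i = j
    · subst hij
      split_ifs <;> first | rfl | (exfalso; simp_all; omega)
    · simp [hij, Ne.symm hij]
  rw [Matrix.mul_assoc, h, ← Matrix.mul_assoc, blockReversal_mul_self, Matrix.one_mul]

theorem jordanShift_one_pow (m : ℕ) : jordanShift p 1 ^ m = jordanShift p m := by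
  induction m with
  | zero => rw [pow_zero, jordanShift_zero]
  | succ m ih =>
    rw [pow_succ', ih]
    ext ⟨i, a⟩ ⟨j, b⟩
    have hb := b.isLt
    rw [jordanShift_mul_apply]
    simp only [jordanShift]
    by_cases hij : i = j
    · subst hij
      split_ifs <;> first | rfl | (exfalso; simp_all; omega)
    · simp [hij]

open Matrix ComplexOrder in
theorem rank_jordanShift (m : ℕ) : (jordanShift p m).rank = ∑ i, (p i - m) := by
  have h : jordanShift p m * (jordanShift p m)ᴴ =
      diagonal fun x => if (x.2 : ℕ) + m < p x.1 then 1 else 0 := by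
    ext ⟨i, a⟩ ⟨j, b⟩
    rw [jordanShift_mul_apply, diagonal_apply]
    simp only [conjTranspose_apply, jordanShift, apply_ite star, star_one, star_zero]
    by_cases hij : i = j
    · subst hij
      simp only [true_and, Sigma.mk.injEq, heq_eq_eq, Fin.ext_iff]
      split_ifs <;> first | rfl | (exfalso; omega)
    · simp [hij, Ne.symm hij]
  rw [← rank_self_mul_conjTranspose, h, rank_diagonal]
  have e : ∀ x : (i : ι) × Fin (p i),
      ((if (x.2 : ℕ) + m < p x.1 then 1 else 0 : ℂ) ≠ 0) ↔ (x.2 : ℕ) + m < p x.1 := by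
    intro x
    simp
  rw [Fintype.card_congr (Equiv.subtypeEquivRight e), Fintype.card_subtype, Finset.card_filter,
    Fintype.sum_sigma]
  refine Finset.sum_congr rfl fun i _ => ?_
  simp only
  rw [Fin.sum_univ_eq_sum_range (fun a => if a + m < p i then 1 else 0), ← Finset.card_filter]
  have : (Finset.range (p i)).filter (fun a => a + m < p i) = Finset.range (p i - m) := by
    ext a
    simp only [Finset.mem_filter, Finset.mem_range]
    omega
  rw [this, Finset.card_range]

end JordanShift

theorem stmt_4 (k : ℕ) (npart : Fin k → ℕ) (hpos : ∀ i, 0 < npart i)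
    (n : ℕ) (hn : n = ∑ i, npart i) :
    ∃ A : Matrix (Fin n) (Fin n) ℂ,
      A.transpose = A ∧ A ^ n = 0 ∧
      -- the Jordan block sizes of `A` are exactly `n_1, …, n_k`:
      -- for every `j ≥ 1`, the number of Jordan blocks of size `≥ j` equals
      -- `rank A^(j-1) - rank A^j`
      (∀ j : ℕ, 1 ≤ j →
        (A ^ (j - 1)).rank - (A ^ j).rank =
          (Finset.univ.filter (fun i => j ≤ npart i)).card) := by
  subst hn
  obtain ⟨U, V, hUV, hVU, hsymm⟩ := exists_symmetric_conj (jordanShift npart 1)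
    (blockReversal npart) (blockReversal_transpose npart) (blockReversal_mul_self npart)
    (blockReversal_conj_jordanShift npart 1)
  set B := U * jordanShift npart 1 * V with hB
  have hpow : ∀ m, B ^ m = U * jordanShift npart m * V := by
    intro m
    rw [← jordanShift_one_pow]
    exact Units.conj_pow ⟨U, V, hUV, hVU⟩ (jordanShift npart 1) m
  have hrank : ∀ m, (B ^ m).rank = ∑ i, (npart i - m) := by
    intro m
    rw [hpow, Matrix.rank_mul_eq_left_of_isUnit_det _ _
        (Matrix.isUnit_det_of_right_inverse hVU),
      Matrix.rank_mul_eq_right_of_isUnit_det _ _ (Matrix.isUnit_det_of_right_inverse hUV),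
      rank_jordanShift]
  have hre : ∀ m, Matrix.reindexAlgEquiv ℂ ℂ (finSigmaFinEquiv (n := npart)) B ^ m =
      (B ^ m).reindex finSigmaFinEquiv finSigmaFinEquiv := by
    intro m
    rw [← map_pow, Matrix.coe_reindexAlgEquiv]
  refine ⟨Matrix.reindexAlgEquiv ℂ ℂ finSigmaFinEquiv B, ?_, ?_, ?_⟩
  · rw [Matrix.coe_reindexAlgEquiv, Matrix.transpose_reindex, hsymm]
  · rw [← map_pow, hpow, jordanShift_eq_zero npart fun i =>
      Finset.single_le_sum (f := npart) (fun _ _ => Nat.zero_le _) (Finset.mem_univ i)]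
    simp
  · intro j hj
    rw [hre, hre, Matrix.rank_reindex, Matrix.rank_reindex, hrank, hrank, Finset.card_filter]
    have : ∑ i, (npart i - (j - 1)) =
        ∑ i, (npart i - j) + ∑ i, if j ≤ npart i then 1 else 0 := by
      rw [← Finset.sum_add_distrib]
      refine Finset.sum_congr rfl fun i _ => ?_
      split_ifs <;> omega
    omega
end

section
/- Let A, B ∈ M_n(ℂ) be nilpotent symmetric matrices (Aᵀ = A, Bᵀ = B) with rank(A^j) = rank(B^j) for every j ≥ 1. Then there exists S in the complex orthogonal group O_n(ℂ) (i.e., Sᵀ S = I) such that B = S A S⁻¹. -/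
open Polynomial in
/-- Over a splitting field, a polynomial vanishing at the roots of `c` has a power divisible
by `c`. -/
theorem exists_dvd_pow_of_isRoot {K : Type*} [Field K] {c h : K[X]} (hc : c.Splits)
    (hm : c.Monic) (H : ∀ a, c.IsRoot a → h.IsRoot a) : ∃ k : ℕ, c ∣ h ^ k := by
  have key : ∀ s : Multiset K, (∀ a ∈ s, h.IsRoot a) →
      (s.map fun a => X - C a).prod ∣ h ^ s.card := by
    intro s
    induction s using Multiset.induction_on with
    | empty => simp
    | cons a s ih =>
      intro hs
      rw [Multiset.map_cons, Multiset.prod_cons, Multiset.card_cons, pow_succ']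
      exact mul_dvd_mul (dvd_iff_isRoot.2 (hs a (by simp)))
        (ih fun b hb => hs b (Multiset.mem_cons_of_mem hb))
  refine ⟨c.roots.card, ?_⟩
  conv_lhs => rw [hc.eq_prod_roots_of_monic hm]
  exact key _ fun a ha => H a (isRoot_of_mem_roots ha)

open Polynomial in
/-- An invertible complex matrix has a square root which is a polynomial in it. -/
theorem Matrix.exists_aeval_sq_eq {n : Type*} [Fintype n] [DecidableEq n] (M : Matrix n n ℂ)
    (hM : IsUnit M) : ∃ p : ℂ[X], aeval M p ^ 2 = M := by
  have h0 : ∀ a, M.charpoly.IsRoot a → a ≠ 0 := by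
    rintro a ha rfl
    have h1 : M.det ≠ 0 := ((Matrix.isUnit_iff_isUnit_det M).1 hM).ne_zero
    rw [Matrix.det_eq_sign_charpoly_coeff, coeff_zero_eq_eval_zero] at h1
    exact h1 (by rw [ha.eq_zero, mul_zero])
  choose r hr using fun a : ℂ => IsAlgClosed.exists_pow_nat_eq a (n := 2) two_pos
  set q : ℂ[X] := Lagrange.interpolate M.charpoly.roots.toFinset id r
  have hq : ∀ a, M.charpoly.IsRoot a → q.eval a = r a := fun a ha =>
    Lagrange.eval_interpolate_at_node (v := id) r (Set.injOn_id _)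
      (Multiset.mem_toFinset.2 ((mem_roots M.charpoly_monic.ne_zero).2 ha))
  obtain ⟨k, d, hk⟩ := exists_dvd_pow_of_isRoot (h := q ^ 2 - X) (IsAlgClosed.splits M.charpoly)
    M.charpoly_monic fun a ha => by simp [IsRoot, hq a ha, hr]
  obtain ⟨u, v, huv⟩ : IsCoprime M.charpoly q := by
    rw [isCoprime_iff_aeval_ne_zero_of_isAlgClosed ℂ ℂ]
    intro a
    by_cases ha : M.charpoly.IsRoot a
    · right
      rw [coe_aeval_eq_eval, hq a ha]
      intro h
      have := hr a
      rw [h] at this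
      exact h0 a ha (by simpa using this.symm)
    · left
      rwa [coe_aeval_eq_eval]
  set m : Algebra.adjoin ℂ {M} := ⟨M, Algebra.self_mem_adjoin_singleton ℂ M⟩
  have hcm : aeval m M.charpoly = 0 :=
    Subtype.ext (by simpa [m, coe_aeval_mk_apply] using M.aeval_self_charpoly)
  have hnil : IsNilpotent (aeval (aeval m q) (X ^ 2 - C m)) := by
    refine ⟨k, ?_⟩
    have := congrArg (aeval m) hk
    simpa [hcm] using this
  have hunit : IsUnit (aeval (aeval m q) (derivative (X ^ 2 - C m))) := by
    have h1 : IsUnit (aeval m q) := by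
      refine IsUnit.of_mul_eq_one_right (aeval m v) ?_
      have := congrArg (aeval m) huv
      simpa [hcm] using this
    have h2 : IsUnit (2 : Algebra.adjoin ℂ {M}) := by
      rw [← map_ofNat (algebraMap ℂ (Algebra.adjoin ℂ {M})) 2]
      exact (IsUnit.mk0 (2 : ℂ) two_ne_zero).map _
    simpa [one_add_one_eq_two] using h2.mul h1
  obtain ⟨⟨s, hs⟩, ⟨-, hss⟩, -⟩ := existsUnique_nilpotent_sub_and_aeval_eq_zero hnil hunit
  rw [Algebra.adjoin_singleton_eq_range_aeval] at hs
  obtain ⟨p, rfl⟩ := hs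
  refine ⟨p, ?_⟩
  have := congrArg Subtype.val hss
  simpa [m, sub_eq_zero] using this

section Extension

variable {K V W : Type*} [Field K] [AddCommGroup V] [Module K V] [AddCommGroup W] [Module K W]

/-- Linear maps on two subspaces that agree on the intersection have a common extension. -/
theorem LinearMap.exists_extend_pair {p q : Submodule K V} (a : p →ₗ[K] W) (b : q →ₗ[K] W)
    (h : ∀ (x : p) (y : q), (x : V) = y → a x = b y) :
    ∃ c : V →ₗ[K] W, (∀ x : p, c x = a x) ∧ ∀ y : q, c y = b y := by
  let f : V →ₗ.[K] W := ⟨p, a⟩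
  let g : V →ₗ.[K] W := ⟨q, b⟩
  obtain ⟨c, hc⟩ := (f.sup g h).toFun.exists_extend
  refine ⟨c, fun x => ?_, fun y => ?_⟩
  · have h1 := LinearMap.congr_fun hc ⟨x, Submodule.mem_sup_left x.2⟩
    exact h1.trans ((f.left_le_sup g h).2 (x := x) rfl).symm
  · have h1 := LinearMap.congr_fun hc ⟨y, Submodule.mem_sup_right y.2⟩
    exact h1.trans ((f.right_le_sup g h).2 (x := y) rfl).symm

/-- An injective linear map on a subspace extends to an injective linear map on the whole space
when the dimensions of the source and target agree. -/
theorem LinearMap.exists_injective_extend [FiniteDimensional K V] [FiniteDimensional K W]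
    (hd : Module.finrank K V = Module.finrank K W) {p : Submodule K V} (a : p →ₗ[K] W)
    (ha : Function.Injective a) :
    ∃ c : V →ₗ[K] W, Function.Injective c ∧ ∀ x : p, c x = a x := by
  obtain ⟨q, hpq⟩ := p.exists_isCompl
  obtain ⟨t, ht⟩ := (LinearMap.range a).exists_isCompl
  have e1 := Submodule.finrank_add_eq_of_isCompl hpq
  have e2 := Submodule.finrank_add_eq_of_isCompl ht
  have e3 := LinearMap.finrank_range_of_inj ha
  obtain ⟨e⟩ := FiniteDimensional.nonempty_linearEquiv_of_finrank_eq
    (show Module.finrank K q = Module.finrank K t by omega)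
  refine ⟨LinearMap.ofIsCompl hpq a (t.subtype ∘ₗ e), ?_, fun x => by simp⟩
  rw [injective_iff_map_eq_zero]
  intro x hx
  obtain ⟨y, z, rfl, -⟩ := Submodule.existsUnique_add_of_isCompl hpq x
  simp only [map_add, LinearMap.ofIsCompl_apply_left, LinearMap.ofIsCompl_apply_right,
    LinearMap.comp_apply, Submodule.subtype_apply, LinearEquiv.coe_coe] at hx
  have hd := Submodule.disjoint_def.1 ht.disjoint (a y) ⟨y, rfl⟩ (by
    rw [eq_neg_of_add_eq_zero_left hx]
    exact t.neg_mem (e z).2)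
  rw [hd, zero_add] at hx
  have hy : y = 0 := ha (by rw [hd, map_zero])
  have hz : z = 0 := e.injective (by rw [map_zero]; exact Subtype.ext hx)
  simp [hy, hz]

/-- An equivalence intertwining the restrictions of two endomorphisms to their ranges extends to
an equivalence intertwining the endomorphisms, if the dimensions agree. -/
theorem LinearMap.exists_equiv_of_range_equiv [FiniteDimensional K V] [FiniteDimensional K W]
    (f : V →ₗ[K] V) (g : W →ₗ[K] W) (hd : Module.finrank K V = Module.finrank K W)
    (φ : LinearMap.range f ≃ₗ[K] LinearMap.range g)
    (hφ : ∀ x : LinearMap.range f, (φ (f.rangeRestrict x) : W) = g (φ x)) :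
    ∃ e : V ≃ₗ[K] W, ∀ x, e (f x) = g (e x) := by
  have hk : Module.finrank K (LinearMap.ker f) = Module.finrank K (LinearMap.ker g) := by
    have h1 := f.finrank_range_add_finrank_ker
    have h2 := g.finrank_range_add_finrank_ker
    have h3 := φ.finrank_eq
    omega
  let u : (LinearMap.range f).comap (LinearMap.ker f).subtype →ₗ[K] LinearMap.ker g :=
    LinearMap.codRestrict _ ((LinearMap.range g).subtype ∘ₗ φ.toLinearMap ∘ₗ
      LinearMap.codRestrict (LinearMap.range f)
        ((LinearMap.ker f).subtype ∘ₗ Submodule.subtype _) fun x => x.2) fun x => by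
          have h1 : φ (f.rangeRestrict x.1.1) = 0 := by
            rw [show f.rangeRestrict x.1.1 = 0 from Subtype.ext x.1.2, map_zero]
          exact (hφ ⟨x.1.1, x.2⟩).symm.trans (congrArg Subtype.val h1)
  have hu_apply : ∀ x, (u x : W) = φ ⟨x.1.1, x.2⟩ := fun _ => rfl
  have hu : Function.Injective u := by
    intro x y hxy
    have h1 : φ ⟨x.1.1, x.2⟩ = φ ⟨y.1.1, y.2⟩ := Subtype.ext (by
      rw [← hu_apply, ← hu_apply, hxy])
    exact Subtype.ext (Subtype.ext (Subtype.mk.inj (φ.injective h1)))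
  obtain ⟨ψ, hψ, hψu⟩ := LinearMap.exists_injective_extend hk u hu
  obtain ⟨s, hs⟩ := g.rangeRestrict.exists_rightInverse_of_surjective g.range_rangeRestrict
  have hs' : ∀ y, g (s y) = y := fun y => congrArg Subtype.val (LinearMap.congr_fun hs y)
  let φ₀ : V →ₗ[K] W := s ∘ₗ φ.toLinearMap ∘ₗ f.rangeRestrict
  have hφ₀ : ∀ v, g (φ₀ v) = φ (f.rangeRestrict v) := fun v => hs' _
  let δ : LinearMap.range f →ₗ[K] LinearMap.ker g :=
    LinearMap.codRestrict _ ((LinearMap.range g).subtype ∘ₗ φ.toLinearMap -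
      φ₀ ∘ₗ (LinearMap.range f).subtype) fun x => by
        simp [LinearMap.mem_ker, hφ₀, ← hφ]
  have hδ : ∀ x, (δ x : W) = φ x - φ₀ x := fun _ => rfl
  obtain ⟨c, hc1, hc2⟩ := LinearMap.exists_extend_pair δ ψ (by
    rintro ⟨x, hx⟩ ⟨y, hy⟩ rfl
    refine Subtype.ext ?_
    have h1 := congrArg Subtype.val (hψu ⟨⟨x, hy⟩, hx⟩)
    have h2 : f.rangeRestrict x = 0 := Subtype.ext hy
    refine Eq.trans ?_ h1.symm
    simp [hδ, hu_apply, φ₀, h2])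
  let e : V →ₗ[K] W := φ₀ + (LinearMap.ker g).subtype ∘ₗ c
  have he1 : ∀ x : LinearMap.range f, e x = φ x := fun x => by
    simp [e, hc1, hδ]
  have he2 : ∀ v, e (f v) = g (e v) := fun v => by
    have h1 := he1 (f.rangeRestrict v)
    have h2 : g (c v) = 0 := (c v).2
    have h3 : g (e v) = g (φ₀ v) + g (c v) := map_add g _ _
    rw [h3, h2, add_zero, hφ₀]
    exact h1
  have hinj : Function.Injective e := by
    rw [injective_iff_map_eq_zero]
    intro v hv
    have h1 : f.rangeRestrict v = 0 := φ.injective (Subtype.ext (by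
      rw [← he1, map_zero]
      exact (he2 v).trans (by rw [hv, map_zero]; rfl)))
    have h2 : v ∈ LinearMap.ker f := congrArg Subtype.val h1
    have h3 : ψ ⟨v, h2⟩ = 0 := by
      refine Subtype.ext ?_
      rw [← hc2]
      simpa [e, φ₀, h1] using hv
    exact congrArg Subtype.val (hψ (h3.trans (map_zero ψ).symm))
  exact ⟨LinearEquiv.ofInjectiveOfFinrankEq e hinj hd, he2⟩

end Extension

section RangeRestriction

variable {K V : Type*} [Field K] [AddCommGroup V] [Module K V]

theorem LinearMap.coe_rangeRestrict_comp_subtype_pow (f : V →ₗ[K] V) (j : ℕ)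
    (x : LinearMap.range f) :
    (((f.rangeRestrict ∘ₗ (LinearMap.range f).subtype) ^ j) x : V) = (f ^ j) x := by
  induction j with
  | zero => simp
  | succ j ih =>
    rw [pow_succ', pow_succ', Module.End.mul_apply, Module.End.mul_apply, ← ih]
    rfl

theorem LinearMap.rangeRestrict_comp_subtype_pow_eq_zero (f : V →ₗ[K] V) {k : ℕ}
    (hf : f ^ (k + 1) = 0) :
    (f.rangeRestrict ∘ₗ (LinearMap.range f).subtype) ^ k = 0 := by
  ext ⟨x, y, rfl⟩
  rw [LinearMap.coe_rangeRestrict_comp_subtype_pow]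
  exact LinearMap.congr_fun hf y

theorem LinearMap.finrank_range_rangeRestrict_comp_subtype_pow (f : V →ₗ[K] V) (j : ℕ) :
    Module.finrank K
      (LinearMap.range ((f.rangeRestrict ∘ₗ (LinearMap.range f).subtype) ^ j)) =
      Module.finrank K (LinearMap.range (f ^ (j + 1))) := by
  rw [← Submodule.finrank_map_subtype_eq]
  suffices h : Submodule.map (LinearMap.range f).subtype
      (LinearMap.range ((f.rangeRestrict ∘ₗ (LinearMap.range f).subtype) ^ j)) =
      LinearMap.range (f ^ (j + 1)) by rw [h]
  ext x
  constructor
  · rintro ⟨-, ⟨⟨-, y, rfl⟩, rfl⟩, rfl⟩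
    exact ⟨y, (f.coe_rangeRestrict_comp_subtype_pow j ⟨f y, y, rfl⟩).symm⟩
  · rintro ⟨y, rfl⟩
    exact ⟨_, ⟨⟨f y, y, rfl⟩, rfl⟩, f.coe_rangeRestrict_comp_subtype_pow j ⟨f y, y, rfl⟩⟩

end RangeRestriction

/-- Nilpotent endomorphisms whose powers have equal ranks are similar. -/
theorem LinearMap.exists_equiv_of_finrank_range_pow_eq {K : Type*} [Field K] (k : ℕ) :
    ∀ {V W : Type*} [AddCommGroup V] [Module K V] [FiniteDimensional K V]
      [AddCommGroup W] [Module K W] [FiniteDimensional K W]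
      (f : V →ₗ[K] V) (g : W →ₗ[K] W), f ^ k = 0 → g ^ k = 0 →
      (∀ j, Module.finrank K (LinearMap.range (f ^ j)) =
        Module.finrank K (LinearMap.range (g ^ j))) →
      ∃ e : V ≃ₗ[K] W, ∀ x, e (f x) = g (e x) := by
  induction k with
  | zero =>
    intro V W _ _ _ _ _ _ f g hf hg _
    have hV : Subsingleton V := ⟨fun x y =>
      (LinearMap.congr_fun hf x).trans (LinearMap.congr_fun hf y).symm⟩
    have hW : Subsingleton W := ⟨fun x y =>
      (LinearMap.congr_fun hg x).trans (LinearMap.congr_fun hg y).symm⟩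
    exact ⟨0, fun x => Subsingleton.elim _ _⟩
  | succ k ih =>
    intro V W _ _ _ _ _ _ f g hf hg h
    have h1 := h 1
    rw [pow_one, pow_one] at h1
    obtain ⟨φ, hφ⟩ := ih (f.rangeRestrict ∘ₗ (LinearMap.range f).subtype)
      (g.rangeRestrict ∘ₗ (LinearMap.range g).subtype)
      (f.rangeRestrict_comp_subtype_pow_eq_zero hf) (g.rangeRestrict_comp_subtype_pow_eq_zero hg)
      fun j => by
        rw [finrank_range_rangeRestrict_comp_subtype_pow,
          finrank_range_rangeRestrict_comp_subtype_pow, h]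
    refine LinearMap.exists_equiv_of_range_equiv f g ?_ φ
      fun x => congrArg Subtype.val (hφ x)
    have h0 := h 0
    rwa [pow_zero, pow_zero, Module.End.one_eq_id, Module.End.one_eq_id, LinearMap.range_id,
      LinearMap.range_id, finrank_top, finrank_top] at h0

/-- Similar symmetric complex matrices are orthogonally similar. -/
theorem Matrix.exists_orthogonal_of_mul_eq_mul {n : Type*} [Fintype n] [DecidableEq n]
    {A B P : Matrix n n ℂ} (hA : A.transpose = A) (hB : B.transpose = B) (hP : IsUnit P)
    (h : P * A = B * P) :
    ∃ S : Matrix n n ℂ, S.transpose * S = 1 ∧ B = S * A * S⁻¹ := by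
  have hPT : IsUnit P.transpose := (Matrix.isUnit_transpose P).2 hP
  obtain ⟨p, hp⟩ := Matrix.exists_aeval_sq_eq (P.transpose * P) (hPT.mul hP)
  have hcomm : Commute A (P.transpose * P) := by
    have h' : A * P.transpose = P.transpose * B := by
      simpa [hA, hB] using congrArg Matrix.transpose h
    rw [Commute, SemiconjBy, ← mul_assoc, h', mul_assoc, mul_assoc, h]
  set M := P.transpose * P with hM
  set Q := Polynomial.aeval M p with hQ
  have hQT : Q.transpose = Q := by
    have hMT : M.transpose = M := by simp [hM]
    rw [hQ, Polynomial.aeval_eq_sum_range]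
    simp [Matrix.transpose_sum, Matrix.transpose_pow, hMT]
  have hAQ : A * Q = Q * A := by
    rw [hQ, Polynomial.aeval_eq_sum_range]
    exact Commute.sum_right _ _ _ fun i _ => (hcomm.pow_right i).smul_right _
  have hQu : IsUnit Q.det := (Matrix.isUnit_iff_isUnit_det Q).1
    ((isUnit_pow_iff two_ne_zero).1 (hp ▸ hPT.mul hP))
  have hQ1 := Matrix.mul_nonsing_inv Q hQu
  have hQ2 := Matrix.nonsing_inv_mul Q hQu
  have hS : (P * Q⁻¹).transpose * (P * Q⁻¹) = 1 := by
    calc (P * Q⁻¹).transpose * (P * Q⁻¹) = Q⁻¹ * M * Q⁻¹ := by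
          rw [Matrix.transpose_mul, Matrix.transpose_nonsing_inv, hQT, hM]
          simp only [mul_assoc]
      _ = (Q⁻¹ * Q) * (Q * Q⁻¹) := by rw [← hp, sq]; simp only [mul_assoc]
      _ = 1 := by rw [hQ1, hQ2, one_mul]
  refine ⟨P * Q⁻¹, hS, ?_⟩
  have hAQ' : A * Q⁻¹ = Q⁻¹ * A := by
    calc A * Q⁻¹ = Q⁻¹ * (Q * A) * Q⁻¹ := by rw [← mul_assoc, hQ2, one_mul]
      _ = Q⁻¹ * A * (Q * Q⁻¹) := by rw [← hAQ]; simp only [mul_assoc]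
      _ = Q⁻¹ * A := by rw [hQ1, mul_one]
  have hSS : (P * Q⁻¹) * (P * Q⁻¹)⁻¹ = 1 := by
    rw [Matrix.inv_eq_left_inv hS]
    exact mul_eq_one_comm.1 hS
  rw [mul_assoc P, ← hAQ', ← mul_assoc P, h, mul_assoc B, mul_assoc B, hSS, mul_one]

theorem stmt_5 (n : ℕ) (A B : Matrix (Fin n) (Fin n) ℂ)
    (hAsym : A.transpose = A) (hBsym : B.transpose = B)
    (hAnil : A ^ n = 0) (hBnil : B ^ n = 0)
    (hrank : ∀ j : ℕ, 1 ≤ j → (A ^ j).rank = (B ^ j).rank) :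
    ∃ S : Matrix (Fin n) (Fin n) ℂ, S.transpose * S = 1 ∧ B = S * A * S⁻¹ := by
  obtain ⟨e, he⟩ := LinearMap.exists_equiv_of_finrank_range_pow_eq n (Matrix.toLin' A)
    (Matrix.toLin' B) (by rw [← Matrix.toLin'_pow, hAnil, map_zero])
    (by rw [← Matrix.toLin'_pow, hBnil, map_zero]) fun j => by
      rw [← Matrix.toLin'_pow, ← Matrix.toLin'_pow]
      rcases j.eq_zero_or_pos with rfl | hj
      · rw [pow_zero, pow_zero]
      · exact hrank j hj
  refine Matrix.exists_orthogonal_of_mul_eq_mul (P := LinearMap.toMatrix' e.toLinearMap)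
    hAsym hBsym ?_ ?_
  · refine IsUnit.of_mul_eq_one (LinearMap.toMatrix' e.symm.toLinearMap) ?_
    rw [← LinearMap.toMatrix'_comp, LinearEquiv.comp_symm, LinearMap.toMatrix'_id]
  · apply Matrix.toLin'.injective
    rw [Matrix.toLin'_mul, Matrix.toLin'_mul, Matrix.toLin'_toMatrix']
    exact LinearMap.ext he
end

section
/- Let (U, ω) be a complex symplectic vector space, and let A, B ∈ End(U) be ω-self-adjoint with A nilpotent and trace zero. Then trace(B ∘ (X ∘ A − A ∘ X)) = 0 for every X ∈ End(U) satisfying ω(X u, v) = −ω(u, X v) for all u, v ∈ U, if and only if A ∘ B = B ∘ A. -/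
/-- A linear endomorphism that is skew-adjoint for a nondegenerate alternating form `ω` vanishes
as soon as it is trace-orthogonal to all `ω`-skew-adjoint endomorphisms. -/
theorem eq_zero_of_trace_mul_skewAdjoint_eq_zero {K V : Type*} [Field K] [NeZero (2 : K)]
    [AddCommGroup V] [Module K V] [FiniteDimensional K V]
    (ω : V →ₗ[K] V →ₗ[K] K) (halt : ω.IsAlt) (hnd : ω.SeparatingLeft)
    {C : Module.End K V} (hC : ∀ u v, ω (C u) v = -ω u (C v))
    (h : ∀ X : Module.End K V, (∀ u v, ω (X u) v = -ω u (X v)) →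
      LinearMap.trace K V (C * X) = 0) : C = 0 := by
  have diag (a : V) : ω (C a) a = 0 := by
    have hX := h ((ω.flip a).smulRight a) fun u v ↦ by
      simp [← halt.neg a v, mul_comm]
    have hmul : C * (ω.flip a).smulRight a = (ω.flip a).smulRight (C a) := by
      ext u
      simp
    rwa [hmul, LinearMap.trace_smulRight, LinearMap.flip_apply] at hX
  ext a
  refine hnd _ fun b ↦ ?_
  have hab := diag (a + b)
  have hsymm : ω (C b) a = ω (C a) b := by rw [hC b a, halt.neg]
  simp only [map_add, LinearMap.add_apply, diag, hsymm, zero_add, add_zero] at hab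
  rw [← two_mul] at hab
  exact (mul_eq_zero.mp hab).resolve_left two_ne_zero

/-- The commutator of two self-adjoint endomorphisms is skew-adjoint. -/
theorem commutator_skewAdjoint {R M : Type*} [CommRing R] [AddCommGroup M] [Module R M]
    (ω : M →ₗ[R] M →ₗ[R] R) {A B : Module.End R M}
    (hA : ∀ u v, ω (A u) v = ω u (A v)) (hB : ∀ u v, ω (B u) v = ω u (B v)) (u v : M) :
    ω ((A * B - B * A) u) v = -ω u ((A * B - B * A) v) := by
  simp [hA, hB]

theorem trace_mul_commutator {R M : Type*} [CommRing R] [AddCommGroup M] [Module R M]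
    (A B X : Module.End R M) :
    LinearMap.trace R M (B * (X * A - A * X)) = LinearMap.trace R M ((A * B - B * A) * X) := by
  rw [mul_sub, sub_mul, map_sub, map_sub, ← mul_assoc B X A, LinearMap.trace_mul_comm R (B * X) A,
    mul_assoc, mul_assoc]


theorem stmt_10 (U : Type*) [AddCommGroup U] [Module ℂ U] [FiniteDimensional ℂ U]
    (ω : U →ₗ[ℂ] U →ₗ[ℂ] ℂ)
    (halt : ∀ u, ω u u = 0)
    (hnd : ∀ u, (∀ v, ω u v = 0) → u = 0)
    (A B : Module.End ℂ U)
    (hAsa : ∀ u v, ω (A u) v = ω u (A v))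
    (hBsa : ∀ u v, ω (B u) v = ω u (B v))
    (hAnil : IsNilpotent A)
    (htrA : LinearMap.trace ℂ U A = 0) :
    (∀ X : Module.End ℂ U, (∀ u v, ω (X u) v = -ω u (X v)) →
        LinearMap.trace ℂ U (B * (X * A - A * X)) = 0) ↔ A * B = B * A := by
  simp only [trace_mul_commutator]
  refine ⟨fun h ↦ sub_eq_zero.mp ?_, fun h X _ ↦ by simp [h]⟩
  exact eq_zero_of_trace_mul_skewAdjoint_eq_zero ω halt hnd
    (commutator_skewAdjoint ω hAsa hBsa) h
end

section
/- Let U be an n-dimensional complex vector space and let A ∈ End(U) be nilpotent with Jordan block sizes n_1, …, n_k (so A has exactly k Jordan blocks, and n = n_1 + ⋯ + n_k). Let B ∈ End(U) commute with A and have exactly k distinct eigenvalues μ_1, …, μ_k, and let U_i be the generalized eigenspace of B for μ_i. Then U = U_1 ⊕ ⋯ ⊕ U_k, each U_i is A-invariant, and there is a permutation σ of {1, …, k} such that dim U_i = n_{σ(i)} and the restriction A|_{U_i} is a regular nilpotent, i.e., (A|_{U_i})^{n_{σ(i)} − 1} ≠ 0. -/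
open Module in
theorem finrank_iSup_eq_sum_finrank {K V ι : Type*} [Field K] [AddCommGroup V] [Module K V]
    [FiniteDimensional K V] [Fintype ι] {p : ι → Submodule K V} (hp : iSupIndep p) :
    finrank K (⨆ i, p i : Submodule K V) = ∑ i, finrank K (p i) := by
  classical
  rw [Submodule.iSup_eq_range_dfinsupp_lsum, LinearMap.finrank_range_of_inj
    hp.dfinsupp_lsum_injective]
  exact finrank_directSum (R := K) fun i => p i

open Module in
theorem finrank_ker_pow_succ_le {K V : Type*} [Field K] [AddCommGroup V] [Module K V]
    [FiniteDimensional K V] (T : End K V) (j : ℕ) :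
    finrank K (LinearMap.ker (T ^ (j + 1))) ≤
      finrank K (LinearMap.ker (T ^ j)) + finrank K (LinearMap.ker T) := by
  set p := LinearMap.ker (T ^ (j + 1))
  rw [← LinearMap.finrank_range_add_finrank_ker ((T ^ j).domRestrict p), add_comm]
  gcongr
  · rw [LinearMap.ker_domRestrict, ← Submodule.finrank_map_subtype_eq]
    refine Submodule.finrank_mono ?_
    rintro _ ⟨x, hx, rfl⟩
    simpa using hx
  · refine Submodule.finrank_mono ?_
    rintro _ ⟨⟨x, hx⟩, rfl⟩
    simpa [p, pow_succ'] using hx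

open Module in
theorem finrank_ker_pow_of_finrank_ker_eq_one {K V : Type*} [Field K] [AddCommGroup V] [Module K V]
    [FiniteDimensional K V] {T : End K V} (hT : IsNilpotent T)
    (h : finrank K (LinearMap.ker T) = 1) (j : ℕ) :
    finrank K (LinearMap.ker (T ^ j)) = min j (finrank K V) := by
  induction j with
  | zero => simp [Module.End.one_eq_id]
  | succ j ih =>
    have h_le := finrank_ker_pow_succ_le T j
    have h_dim := Submodule.finrank_le (LinearMap.ker (T ^ (j + 1)))
    have h_mono : LinearMap.ker (T ^ j) ≤ LinearMap.ker (T ^ (j + 1)) := by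
      rw [pow_succ']
      exact LinearMap.ker_le_ker_comp _ _
    have h_rank := Submodule.finrank_mono h_mono
    have h_stab : finrank K (LinearMap.ker (T ^ j)) = finrank K (LinearMap.ker (T ^ (j + 1))) →
        finrank K (LinearMap.ker (T ^ j)) = finrank K V := by
      intro heq
      obtain ⟨m, hm⟩ := hT
      have := End.ker_pow_constant (Submodule.eq_of_le_of_finrank_eq h_mono heq) m
      rw [this, pow_add, hm, mul_zero, LinearMap.ker_zero, finrank_top]
    omega

theorem exists_perm_of_card_filter_le_eq {ι : Type*} [Fintype ι] {f g : ι → ℕ}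
    (h : ∀ j, (Finset.univ.filter (fun i => j ≤ f i)).card =
      (Finset.univ.filter (fun i => j ≤ g i)).card) :
    ∃ σ : Equiv.Perm ι, ∀ i, f i = g (σ i) := by
  have key (f : ι → ℕ) (j : ℕ) : (Finset.univ.filter (fun i => j ≤ f i)).card =
      (Finset.univ.filter (fun i => f i = j)).card +
      (Finset.univ.filter (fun i => j + 1 ≤ f i)).card := by
    classical
    rw [← Finset.card_union_of_disjoint]
    · congr 1
      ext i
      simp
      omega
    · rw [Finset.disjoint_filter]
      intros
      omega
  have hcard (j : ℕ) : Fintype.card {i // f i = j} = Fintype.card {i // g i = j} := by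
    rw [Fintype.card_subtype, Fintype.card_subtype]
    have := key f j
    have := key g j
    have := h j
    have := h (j + 1)
    omega
  let e (j : ℕ) : {i // f i = j} ≃ {i // g i = j} := Fintype.equivOfCardEq (hcard j)
  refine ⟨Equiv.ofFiberEquiv e, fun i => (Equiv.ofFiberEquiv_map e i).symm⟩

open Module in
theorem iSup_comp_maxGenEigenspace_inf_eq {V ι : Type*} [AddCommGroup V] [Module ℂ V]
    [FiniteDimensional ℂ V] {B : End ℂ V} {μ : ι → ℂ}
    (hμ : ∀ c, B.HasEigenvalue c → c ∈ Set.range μ) {p : Submodule ℂ V}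
    (hp : ∀ x ∈ p, B x ∈ p) :
    ⨆ i, p ⊓ B.maxGenEigenspace (μ i) = p := by
  refine le_antisymm (iSup_le fun i => inf_le_left) ?_
  have h := Submodule.inf_iSup_genEigenspace hp ⊤
  rw [show ⨆ c, B.genEigenspace c ⊤ = ⊤ from B.iSup_maxGenEigenspace_eq_top, inf_top_eq] at h
  conv_lhs => rw [h]
  refine iSup_le fun c => ?_
  by_cases hc : B.HasEigenvalue c
  · obtain ⟨i, rfl⟩ := hμ c hc
    exact le_iSup (fun i => p ⊓ B.maxGenEigenspace (μ i)) i
  · have hbot : B.genEigenspace c ⊤ = ⊥ := by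
      by_contra hne
      exact hc (End.HasUnifEigenvalue.lt (k := ⊤) one_pos hne)
    simp [hbot]

open Module in
theorem finrank_ker_pow_restrict {K V : Type*} [Field K] [AddCommGroup V] [Module K V]
    {A : End K V} {p : Submodule K V} (hp : ∀ x ∈ p, A x ∈ p) (j : ℕ) :
    finrank K (LinearMap.ker (A.restrict hp ^ j)) =
      finrank K (LinearMap.ker (A ^ j) ⊓ p : Submodule K V) := by
  rw [← Submodule.finrank_map_subtype_eq, End.pow_restrict]
  have h : (LinearMap.ker ((A ^ j).restrict (End.pow_apply_mem_of_forall_mem j hp))).map p.subtype =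
      LinearMap.ker (A ^ j) ⊓ p := by
    ext x
    simp [LinearMap.restrict_apply, and_comm]
  rw [h]

open Module in
theorem finrank_ker_eq_one_of_sum_le {K ι : Type*} [Field K] [Fintype ι] {W : ι → Type*}
    [∀ i, AddCommGroup (W i)] [∀ i, Module K (W i)] [∀ i, FiniteDimensional K (W i)]
    [∀ i, Nontrivial (W i)] {T : ∀ i, End K (W i)} (hT : ∀ i, IsNilpotent (T i))
    (h : ∑ i, finrank K (LinearMap.ker (T i)) ≤ Fintype.card ι) (i : ι) :
    finrank K (LinearMap.ker (T i)) = 1 := by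
  have hpos (i : ι) : 1 ≤ finrank K (LinearMap.ker (T i)) := by
    rw [Nat.one_le_iff_ne_zero, Ne, Submodule.finrank_eq_zero]
    intro hbot
    obtain ⟨m, hm⟩ := hT i
    have hinj : Function.Injective (T i ^ m) := by
      rw [End.coe_pow]
      exact (LinearMap.ker_eq_bot.1 hbot).iterate m
    rw [hm] at hinj
    obtain ⟨x, hx⟩ := exists_ne (0 : W i)
    exact hx (hinj (by simp))
  have hsum : ∑ _i : ι, 1 = ∑ i, finrank K (LinearMap.ker (T i)) :=
    le_antisymm (Finset.sum_le_sum fun i _ => hpos i) (by simpa using h)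
  exact ((Finset.sum_eq_sum_iff_of_le fun i _ => hpos i).1 hsum i (Finset.mem_univ i)).symm

theorem sum_min_succ {ι : Type*} [Fintype ι] (d : ι → ℕ) (j : ℕ) :
    ∑ i, min (j + 1) (d i) =
      ∑ i, min j (d i) + (Finset.univ.filter (fun i => j + 1 ≤ d i)).card := by
  rw [Finset.card_filter, ← Finset.sum_add_distrib]
  refine Finset.sum_congr rfl fun i _ => ?_
  split_ifs <;> omega

theorem stmt_11 (k : ℕ) (npart : Fin k → ℕ) (hpos : ∀ i, 0 < npart i)
    (U : Type*) [AddCommGroup U] [Module ℂ U] [FiniteDimensional ℂ U]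
    (n : ℕ) (hdim : Module.finrank ℂ U = n) (hsum : ∑ i, npart i = n)
    (A : Module.End ℂ U) (hAnil : IsNilpotent A)
    -- the Jordan block sizes of `A` are `n_1, …, n_k`: for every `j ≥ 1`, the
    -- number of Jordan blocks of size `≥ j` equals `rank A^(j-1) - rank A^j`
    (hJordan : ∀ j : ℕ, 1 ≤ j →
      Module.finrank ℂ (LinearMap.range (A ^ (j - 1))) -
        Module.finrank ℂ (LinearMap.range (A ^ j)) =
      (Finset.univ.filter (fun i => j ≤ npart i)).card)
    (B : Module.End ℂ U) (hcomm : A * B = B * A)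
    (μ : Fin k → ℂ) (hinj : Function.Injective μ)
    -- `B` has exactly the `k` distinct eigenvalues `μ 1, …, μ k`
    (heig : ∀ c : ℂ, Module.End.HasEigenvalue B c ↔ c ∈ Set.range μ)
    (Usub : Fin k → Submodule ℂ U)
    -- `Usub i` is the generalized eigenspace of `B` for `μ i`
    (hU : ∀ i, Usub i = LinearMap.ker ((B - μ i • 1) ^ n)) :
    DirectSum.IsInternal Usub ∧
    (∀ i, ∀ x ∈ Usub i, A x ∈ Usub i) ∧
    ∃ σ : Equiv.Perm (Fin k),
      (∀ i, Module.finrank ℂ (Usub i) = npart (σ i)) ∧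
      (∀ i, ∃ x ∈ Usub i, (A ^ (npart (σ i) - 1)) x ≠ 0) := by
  have hmax (i : Fin k) : Usub i = B.maxGenEigenspace (μ i) := by
    rw [hU, Module.End.maxGenEigenspace_eq_genEigenspace_finrank, hdim,
      Module.End.genEigenspace_nat]
  obtain rfl : Usub = fun i => B.maxGenEigenspace (μ i) := funext hmax
  have hspec : ∀ c, B.HasEigenvalue c → c ∈ Set.range μ := fun c => (heig c).1
  have hindep : iSupIndep fun i => B.maxGenEigenspace (μ i) :=
    B.independent_maxGenEigenspace.comp hinj
  have hinv (i : Fin k) : ∀ x ∈ B.maxGenEigenspace (μ i), A x ∈ B.maxGenEigenspace (μ i) :=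
    Module.End.mapsTo_maxGenEigenspace_of_comm hcomm.symm (μ i)
  refine ⟨DirectSum.isInternal_submodule_of_iSupIndep_of_iSup_eq_top hindep ?_, hinv, ?_⟩
  · simpa using iSup_comp_maxGenEigenspace_inf_eq hspec (p := ⊤) (by simp)
  let T (i : Fin k) : Module.End ℂ (B.maxGenEigenspace (μ i)) := A.restrict (hinv i)
  have hTnil (i : Fin k) : IsNilpotent (T i) := Module.End.isNilpotent.restrict (hinv i) hAnil
  have hker (j : ℕ) : Module.finrank ℂ (LinearMap.ker (A ^ j)) =
      ∑ i, Module.finrank ℂ (LinearMap.ker (T i ^ j)) := by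
    have hBker : ∀ x ∈ LinearMap.ker (A ^ j), B x ∈ LinearMap.ker (A ^ j) := by
      intro x hx
      have hAB : A ^ j * B = B * A ^ j := (Commute.pow_left hcomm j).eq
      rw [LinearMap.mem_ker] at hx ⊢
      rw [← Module.End.mul_apply, hAB, Module.End.mul_apply, hx, map_zero]
    conv_lhs => rw [← iSup_comp_maxGenEigenspace_inf_eq hspec hBker]
    rw [finrank_iSup_eq_sum_finrank (hindep.mono fun i => inf_le_right)]
    exact Finset.sum_congr rfl fun i _ => (finrank_ker_pow_restrict (hinv i) j).symm
  have hrank (j : ℕ) := LinearMap.finrank_range_add_finrank_ker (A ^ j)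
  have hT1 : ∀ i, Module.finrank ℂ (LinearMap.ker (T i)) = 1 := by
    have (i : Fin k) : Nontrivial (B.maxGenEigenspace (μ i)) := by
      rw [Submodule.nontrivial_iff_ne_bot]
      exact ne_bot_of_le_ne_bot ((heig (μ i)).2 ⟨i, rfl⟩)
        Module.End.eigenspace_le_maxGenEigenspace
    refine finrank_ker_eq_one_of_sum_le hTnil ?_
    have h1 := hJordan 1 le_rfl
    rw [Finset.filter_true_of_mem fun i _ => Nat.one_le_iff_ne_zero.2 (hpos i).ne',
      Finset.card_univ, Nat.sub_self] at h1
    have hk1 : Module.finrank ℂ (LinearMap.ker (A ^ 1)) =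
        ∑ i, Module.finrank ℂ (LinearMap.ker (T i)) :=
      (hker 1).trans (Finset.sum_congr rfl fun i _ => by rw [pow_one])
    have hk0 : Module.finrank ℂ (LinearMap.ker (A ^ 0)) = 0 := by
      rw [pow_zero, Module.End.one_eq_id, LinearMap.ker_id, finrank_bot]
    have hr0 := hrank 0
    have hr1 := hrank 1
    omega
  have hTj (i : Fin k) (j : ℕ) := finrank_ker_pow_of_finrank_ker_eq_one (hTnil i) (hT1 i) j
  obtain ⟨σ, hσ⟩ : ∃ σ : Equiv.Perm (Fin k),
      ∀ i, Module.finrank ℂ (B.maxGenEigenspace (μ i)) = npart (σ i) := by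
    refine exists_perm_of_card_filter_le_eq fun j => ?_
    cases j with
    | zero => simp
    | succ j =>
      have hj := hJordan (j + 1) (Nat.succ_pos j)
      have hmin := sum_min_succ (fun i => Module.finrank ℂ (B.maxGenEigenspace (μ i))) j
      simp only [← hTj, ← hker] at hmin
      have := hrank j
      have := hrank (j + 1)
      rw [Nat.add_sub_cancel] at hj
      omega
  refine ⟨σ, hσ, fun i => ?_⟩
  by_contra! hzero
  have htop : LinearMap.ker (T i ^ (npart (σ i) - 1)) = ⊤ := by
    rw [LinearMap.ker_eq_top]
    ext x
    rw [Module.End.pow_restrict]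
    simpa using hzero x x.2
  have hlt := hTj i (npart (σ i) - 1)
  rw [htop, finrank_top, hσ] at hlt
  have := hpos (σ i)
  omega
end

section
/- Let U be an n-dimensional complex vector space with a nondegenerate symmetric bilinear form ν, let A ∈ End(U) be nilpotent and ν-self-adjoint with Jordan block sizes n_1, …, n_k (so n = n_1 + ⋯ + n_k), and let B ∈ End(U) be ν-self-adjoint, commute with A, and have exactly k distinct eigenvalues with generalized eigenspaces U_1, …, U_k. Then U = U_1 ⊕ ⋯ ⊕ U_k, this decomposition is ν-orthogonal, each U_i is A-invariant, and there is a permutation σ of {1, …, k} such that dim U_i = n_{σ(i)} and (A|_{U_i})^{n_{σ(i)} − 1} ≠ 0 (A|_{U_i} is a regular nilpotent). -/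
open Module in
/-- The dimension of an independent finite supremum is the sum of the dimensions. -/
theorem finrank_iSup_of_iSupIndep {K V ι : Type*} [Field K] [AddCommGroup V] [Module K V]
    [FiniteDimensional K V] [Fintype ι] (p : ι → Submodule K V) (hp : iSupIndep p) :
    finrank K ↥(⨆ i, p i) = ∑ i, finrank K (p i) := by
  classical
  rw [Submodule.iSup_eq_range_dfinsupp_lsum,
    LinearMap.finrank_range_of_inj hp.dfinsupp_lsum_injective]
  exact finrank_directSum (R := K) (fun i => ↥(p i))

open Module in
/-- Rank-nullity for the restriction of a linear map to a submodule. -/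
theorem finrank_map_add_finrank_ker_inf {K V : Type*} [Field K] [AddCommGroup V] [Module K V]
    [FiniteDimensional K V] (f : End K V) (W : Submodule K V) :
    finrank K (W.map f) + finrank K ↥(LinearMap.ker f ⊓ W) = finrank K W := by
  have h := LinearMap.finrank_range_add_finrank_ker (f.domRestrict W)
  rw [LinearMap.range_domRestrict, LinearMap.ker_domRestrict] at h
  rw [← h, inf_comm, ← Submodule.finrank_map_subtype_eq W, Submodule.map_comap_subtype]

/-- A nilpotent endomorphism has nonzero kernel on every nonzero invariant submodule. -/
theorem IsNilpotent.ker_inf_ne_bot {K V : Type*} [Field K] [AddCommGroup V] [Module K V]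
    {f : Module.End K V} (hf : IsNilpotent f) {W : Submodule K V} (hW : ∀ x ∈ W, f x ∈ W)
    (hne : W ≠ ⊥) : LinearMap.ker f ⊓ W ≠ ⊥ := by
  intro hbot
  obtain ⟨m, hm⟩ := hf
  refine hne ((Submodule.eq_bot_iff _).2 fun x hx => ?_)
  have key : ∀ j : ℕ, ∀ y ∈ W, (f ^ j) y = 0 → y = 0 := by
    intro j
    induction j with
    | zero => intro y _ h; simpa using h
    | succ j ih =>
      intro y hy h
      rw [_root_.pow_succ, Module.End.mul_apply] at h
      have hfy := ih _ (hW y hy) h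
      have : y ∈ LinearMap.ker f ⊓ W := ⟨hfy, hy⟩
      rwa [hbot, Submodule.mem_bot] at this
  exact key m x hx (by simp [hm])

open Module in
/-- If a nilpotent `f` has one-dimensional kernel on an invariant submodule `W`, then the powers
of `f` drop the dimension of `W` by exactly one at each step until it reaches zero. -/
theorem IsNilpotent.finrank_map_pow {K V : Type*} [Field K] [AddCommGroup V] [Module K V]
    [FiniteDimensional K V] {f : End K V} (hf : IsNilpotent f) {W : Submodule K V}
    (hW : ∀ x ∈ W, f x ∈ W) (hker : finrank K ↥(LinearMap.ker f ⊓ W) = 1) (j : ℕ) :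
    finrank K (W.map (f ^ j)) = finrank K W - j := by
  have hinv : ∀ j : ℕ, ∀ x ∈ W, (f ^ j) x ∈ W := by
    intro j
    induction j with
    | zero => intro x hx; simpa using hx
    | succ j ih => intro x hx; rw [_root_.pow_succ, End.mul_apply]; exact ih _ (hW x hx)
  induction j with
  | zero => rw [_root_.pow_zero, End.one_eq_id, Submodule.map_id, Nat.sub_zero]
  | succ j ih =>
    have hmap : W.map (f ^ (j + 1)) = (W.map (f ^ j)).map f := by
      rw [pow_succ', End.mul_eq_comp, Submodule.map_comp]
    have hle : W.map (f ^ j) ≤ W := by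
      rintro _ ⟨x, hx, rfl⟩
      exact hinv j x hx
    have hrk := finrank_map_add_finrank_ker_inf f (W.map (f ^ j))
    rw [← hmap] at hrk
    by_cases hbot : W.map (f ^ j) = ⊥
    · have : finrank K (W.map (f ^ j)) = 0 := by rw [hbot]; simp
      omega
    · have hne : LinearMap.ker f ⊓ W.map (f ^ j) ≠ ⊥ := by
        refine hf.ker_inf_ne_bot ?_ hbot
        rintro _ ⟨x, hx, rfl⟩
        refine ⟨f x, hW x hx, ?_⟩
        rw [← End.mul_apply, ← End.mul_apply, ← _root_.pow_succ, ← _root_.pow_succ']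
      have h1 := Submodule.one_le_finrank_iff.2 hne
      have h2 : finrank K ↥(LinearMap.ker f ⊓ W.map (f ^ j)) ≤ 1 :=
        hker ▸ Submodule.finrank_mono (inf_le_inf_left _ hle)
      omega

/-- Two families of natural numbers with the same tail counts agree up to a permutation. -/
theorem exists_perm_of_card_filter_le {ι : Type*} [Fintype ι] (a b : ι → ℕ)
    (h : ∀ j, (Finset.univ.filter (fun i => j ≤ a i)).card =
      (Finset.univ.filter (fun i => j ≤ b i)).card) :
    ∃ σ : Equiv.Perm ι, ∀ i, a i = b (σ i) := by
  classical
  have hsplit : ∀ (c : ι → ℕ) (j : ℕ), (Finset.univ.filter (fun i => j ≤ c i)).card =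
      (Finset.univ.filter (fun i => c i = j)).card +
        (Finset.univ.filter (fun i => j + 1 ≤ c i)).card := by
    intro c j
    rw [← Finset.card_union_of_disjoint]
    · congr 1
      ext i
      simp only [Finset.mem_filter, Finset.mem_univ, true_and, Finset.mem_union]
      omega
    · rw [Finset.disjoint_filter]
      intro i _ _
      omega
  have hfib : ∀ j, Fintype.card { i // a i = j } = Fintype.card { i // b i = j } := by
    intro j
    rw [Fintype.card_subtype, Fintype.card_subtype]
    have h1 := hsplit a j
    have h2 := hsplit b j
    have h3 := h j
    have h4 := h (j + 1)
    omega
  exact ⟨Equiv.ofFiberEquiv fun j => Fintype.equivOfCardEq (hfib j),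
    fun i => (Equiv.ofFiberEquiv_map _ i).symm⟩

/-- Distinct generalized eigenspaces of a self-adjoint endomorphism are orthogonal. -/
theorem apply_eq_zero_of_mem_genEigenspace {K V : Type*} [Field K] [AddCommGroup V] [Module K V]
    [FiniteDimensional K V] (ν : V →ₗ[K] V →ₗ[K] K) (f : Module.End K V)
    (hf : ∀ u v, ν (f u) v = ν u (f v)) {a b : K} (hab : a ≠ b) (n : ℕ) {x y : V}
    (hx : x ∈ f.genEigenspace a n) (hy : y ∈ f.genEigenspace b n) : ν x y = 0 := by
  set T : Module.End K V := (f - a • 1) ^ n with hT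
  have hTsa : ∀ u v, ν (T u) v = ν u (T v) := by
    rw [hT]
    generalize n = m
    induction m with
    | zero => simp
    | succ m ih =>
      intro u v
      rw [pow_succ, Module.End.mul_apply, ih, ← pow_succ, pow_succ', Module.End.mul_apply]
      simp [hf]
  have hmaps : Set.MapsTo T (f.genEigenspace b n) (f.genEigenspace b n) :=
    Module.End.mapsTo_genEigenspace_of_comm
      (((Commute.refl f).sub_right ((Commute.one_right f).smul_right a)).pow_right n) b n
  have hsurj : Function.Surjective (T.restrict hmaps) := by
    rw [← LinearMap.injective_iff_surjective, ← LinearMap.ker_eq_bot, LinearMap.ker_eq_bot']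
    intro z hz
    have hza : (z : V) ∈ f.genEigenspace a n := by
      rw [Module.End.mem_genEigenspace_nat, LinearMap.mem_ker]
      exact congrArg Subtype.val hz
    exact Subtype.ext ((Submodule.disjoint_def.1
      (Module.End.disjoint_genEigenspace f hab n n)) z hza z.2)
  obtain ⟨z, hz⟩ := hsurj ⟨y, hy⟩
  have hzy : T z = y := congrArg Subtype.val hz
  rw [Module.End.mem_genEigenspace_nat, LinearMap.mem_ker] at hx
  rw [← hzy, ← hTsa, hT, hx, map_zero, LinearMap.zero_apply]


theorem stmt_13 (k : ℕ) (npart : Fin k → ℕ) (hpos : ∀ i, 0 < npart i)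
    (U : Type*) [AddCommGroup U] [Module ℂ U] [FiniteDimensional ℂ U]
    (n : ℕ) (hdim : Module.finrank ℂ U = n) (hsum : ∑ i, npart i = n)
    (ν : U →ₗ[ℂ] U →ₗ[ℂ] ℂ)
    (hsym : ∀ x y, ν x y = ν y x)
    (hnd : ∀ x, (∀ y, ν x y = 0) → x = 0)
    (A : Module.End ℂ U) (hAnil : IsNilpotent A)
    (hAsa : ∀ u v, ν (A u) v = ν u (A v))
    -- the Jordan block sizes of `A` are `n_1, …, n_k`: for every `j ≥ 1`, the
    -- number of Jordan blocks of size `≥ j` equals `rank A^(j-1) - rank A^j`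
    (hJordan : ∀ j : ℕ, 1 ≤ j →
      Module.finrank ℂ (LinearMap.range (A ^ (j - 1))) -
        Module.finrank ℂ (LinearMap.range (A ^ j)) =
      (Finset.univ.filter (fun i => j ≤ npart i)).card)
    (B : Module.End ℂ U)
    (hBsa : ∀ u v, ν (B u) v = ν u (B v))
    (hcomm : A * B = B * A)
    (μ : Fin k → ℂ) (hinj : Function.Injective μ)
    -- `B` has exactly the `k` distinct eigenvalues `μ 1, …, μ k`
    (heig : ∀ c : ℂ, Module.End.HasEigenvalue B c ↔ c ∈ Set.range μ)
    (Usub : Fin k → Submodule ℂ U)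
    -- `Usub i` is the generalized eigenspace of `B` for `μ i`
    (hU : ∀ i, Usub i = LinearMap.ker ((B - μ i • 1) ^ n)) :
    DirectSum.IsInternal Usub ∧
    (∀ i j, i ≠ j → ∀ x ∈ Usub i, ∀ y ∈ Usub j, ν x y = 0) ∧
    (∀ i, ∀ x ∈ Usub i, A x ∈ Usub i) ∧
    ∃ σ : Equiv.Perm (Fin k),
      (∀ i, Module.finrank ℂ (Usub i) = npart (σ i)) ∧
      (∀ i, ∃ x ∈ Usub i, (A ^ (npart (σ i) - 1)) x ≠ 0) := by
  have hgen : ∀ i, Usub i = B.genEigenspace (μ i) n := fun i => by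
    rw [hU, Module.End.genEigenspace_nat]
  have hmax : ∀ c, B.maxGenEigenspace c = B.genEigenspace c n := fun c => by
    rw [Module.End.maxGenEigenspace_eq_genEigenspace_finrank, hdim]
  have hUmax : Usub = fun i => B.maxGenEigenspace (μ i) := by
    funext i
    rw [hgen, hmax]
  have hind : iSupIndep Usub := by
    rw [hUmax]
    exact (Module.End.independent_maxGenEigenspace B).comp hinj
  have htop : ⨆ i, Usub i = ⊤ := by
    rw [eq_top_iff, ← Module.End.iSup_maxGenEigenspace_eq_top B]
    refine iSup_le fun c => ?_
    by_cases hc : c ∈ Set.range μ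
    · obtain ⟨i, rfl⟩ := hc
      rw [hUmax]
      exact le_iSup (fun i => B.maxGenEigenspace (μ i)) i
    · rw [← heig] at hc
      have hbot : B.maxGenEigenspace c = ⊥ := by
        by_contra h
        exact hc (Module.End.HasUnifEigenvalue.lt (k := ⊤) zero_lt_one h)
      rw [hbot]
      exact bot_le
  have hinv : ∀ i, ∀ x ∈ Usub i, A x ∈ Usub i := by
    intro i x hx
    rw [hgen] at hx ⊢
    exact Module.End.mapsTo_genEigenspace_of_comm (f := B) (g := A) hcomm.symm (μ i) n hx
  have hinvpow : ∀ (j : ℕ) (i), ∀ x ∈ Usub i, (A ^ j) x ∈ Usub i := by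
    intro j i x hx
    rw [hgen] at hx ⊢
    exact Module.End.mapsTo_genEigenspace_of_comm (f := B) (g := A ^ j)
      ((show Commute B A from hcomm.symm).pow_right j) (μ i) n hx
  have hne : ∀ i, Usub i ≠ ⊥ := by
    intro i hbot
    have hev := (heig (μ i)).2 ⟨i, rfl⟩
    refine hev (eq_bot_iff.2 (le_trans ?_ hbot.le))
    rw [hUmax]
    exact (B.genEigenspace (μ i)).monotone le_top
  have hrange : ∀ j : ℕ, Module.finrank ℂ (LinearMap.range (A ^ j)) =
      ∑ i, Module.finrank ℂ ((Usub i).map (A ^ j)) := by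
    intro j
    rw [LinearMap.range_eq_map, ← htop, Submodule.map_iSup]
    refine finrank_iSup_of_iSupIndep _ (hind.mono fun i => ?_)
    rintro _ ⟨x, hx, rfl⟩
    exact hinvpow j i x hx
  have hpos_ker : ∀ i, 1 ≤ Module.finrank ℂ ↥(LinearMap.ker A ⊓ Usub i) := fun i =>
    Submodule.one_le_finrank_iff.2 (hAnil.ker_inf_ne_bot (hinv i) (hne i))
  have hsum_ker : ∑ i, Module.finrank ℂ ↥(LinearMap.ker A ⊓ Usub i) = ∑ _i : Fin k, 1 := by
    have h1 := hJordan 1 le_rfl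
    rw [Finset.filter_true_of_mem (fun i _ => Nat.succ_le_of_lt (hpos i)), Nat.sub_self, hrange,
      hrange] at h1
    have h2 : ∑ i, Module.finrank ℂ ((Usub i).map (A ^ 0)) =
        ∑ i, Module.finrank ℂ ((Usub i).map (A ^ 1)) +
          ∑ i, Module.finrank ℂ ↥(LinearMap.ker A ⊓ Usub i) := by
      rw [← Finset.sum_add_distrib]
      refine Finset.sum_congr rfl fun i _ => ?_
      rw [pow_one, finrank_map_add_finrank_ker_inf, pow_zero, Module.End.one_eq_id,
        Submodule.map_id]
    rw [Finset.sum_const, smul_eq_mul, mul_one]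
    omega
  have hker : ∀ i, Module.finrank ℂ ↥(LinearMap.ker A ⊓ Usub i) = 1 := fun i =>
    ((Finset.sum_eq_sum_iff_of_le fun i _ => hpos_ker i).1 hsum_ker.symm i
      (Finset.mem_univ i)).symm
  have hmap : ∀ i (j : ℕ), Module.finrank ℂ ((Usub i).map (A ^ j)) =
      Module.finrank ℂ (Usub i) - j := fun i j => hAnil.finrank_map_pow (hinv i) (hker i) j
  have hcount : ∀ j : ℕ, (Finset.univ.filter (fun i => j ≤ Module.finrank ℂ (Usub i))).card =
      (Finset.univ.filter (fun i => j ≤ npart i)).card := by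
    intro j
    rcases Nat.eq_zero_or_pos j with rfl | hj
    · simp
    · rw [← hJordan j hj, hrange, hrange, Finset.card_filter]
      refine (Nat.sub_eq_of_eq_add ?_).symm
      rw [← Finset.sum_add_distrib]
      refine Finset.sum_congr rfl fun i _ => ?_
      rw [hmap, hmap]
      split_ifs <;> omega
  obtain ⟨σ, hσ⟩ := exists_perm_of_card_filter_le _ _ hcount
  refine ⟨DirectSum.isInternal_submodule_of_iSupIndep_of_iSup_eq_top hind htop, ?_, hinv, σ, hσ,
    fun i => ?_⟩
  · intro i j hij x hx y hy
    rw [hgen] at hx hy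
    exact apply_eq_zero_of_mem_genEigenspace ν B hBsa (hinj.ne hij) n hx hy
  · by_contra! hzero
    have hbot : (Usub i).map (A ^ (npart (σ i) - 1)) = ⊥ := by
      rw [Submodule.eq_bot_iff]
      rintro _ ⟨x, hx, rfl⟩
      exact hzero x hx
    have hrk := hmap i (npart (σ i) - 1)
    rw [hbot, finrank_bot, hσ i] at hrk
    have := hpos (σ i)
    omega
end

section
/- Let (U, ω) be a complex symplectic vector space of dimension 2m and let A ∈ End(U) be nilpotent and ω-self-adjoint with exactly two Jordan blocks, each of size m. Then there exist A-invariant Lagrangian subspaces U⁺ and U⁻ of U such that U = U⁺ ⊕ U⁻. -/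
section SelfAdjoint

variable {K U : Type*} [Field K] [AddCommGroup U] [Module K U]
  {ω : U →ₗ[K] U →ₗ[K] K} {A : Module.End K U}

theorem form_pow_apply_left (hA : ∀ u v, ω (A u) v = ω u (A v)) (j : ℕ) (u v : U) :
    ω ((A ^ j) u) v = ω u ((A ^ j) v) := by
  induction j generalizing u v with
  | zero => simp
  | succ j ih =>
    rw [pow_succ', Module.End.mul_apply, hA, ih, ← Module.End.mul_apply, ← pow_succ, pow_succ']

theorem form_pow_pow (hA : ∀ u v, ω (A u) v = ω u (A v)) (i j : ℕ) (u v : U) :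
    ω ((A ^ i) u) ((A ^ j) v) = ω ((A ^ (j + i)) u) v := by
  rw [← form_pow_apply_left hA, ← Module.End.mul_apply, ← pow_add]

/-- If `ω` is alternating and `A` is `ω`-self-adjoint, the `A`-orbit of a vector is isotropic. -/
theorem form_pow_pow_self [NeZero (2 : K)] (halt : ∀ u, ω u u = 0)
    (hA : ∀ u v, ω (A u) v = ω u (A v)) (i j : ℕ) (u : U) :
    ω ((A ^ i) u) ((A ^ j) u) = 0 := by
  have hskew : ω ((A ^ (j + i)) u) u = -ω u ((A ^ (j + i)) u) :=
    neg_eq_iff_eq_neg.mp (LinearMap.IsAlt.neg (B := ω) halt _ _)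
  rw [← form_pow_apply_left hA] at hskew
  rw [form_pow_pow hA]
  have h2 : (2 : K) * ω ((A ^ (j + i)) u) u = 0 := by linear_combination hskew
  exact (mul_eq_zero.mp h2).resolve_left two_ne_zero

/-- The span of `e, A e, …, A ^ (m - 1) e`. -/
def cyclicSpan (A : Module.End K U) (m : ℕ) (e : U) : Submodule K U :=
  Submodule.span K (Set.range fun i : Fin m => (A ^ (i : ℕ)) e)

theorem pow_apply_mem_cyclicSpan {m : ℕ} (hAm : A ^ m = 0) (e : U) (j : ℕ) :
    (A ^ j) e ∈ cyclicSpan A m e := by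
  rcases lt_or_ge j m with h | h
  · exact Submodule.subset_span ⟨⟨j, h⟩, rfl⟩
  · simp [pow_eq_zero_of_le h hAm]

theorem apply_mem_cyclicSpan {m : ℕ} (hAm : A ^ m = 0) (e : U) {x : U}
    (hx : x ∈ cyclicSpan A m e) : A x ∈ cyclicSpan A m e := by
  suffices h : cyclicSpan A m e ≤ (cyclicSpan A m e).comap A from h hx
  refine Submodule.span_le.mpr ?_
  rintro _ ⟨i, rfl⟩
  change A ((A ^ (i : ℕ)) e) ∈ cyclicSpan A m e
  rw [← Module.End.mul_apply, ← pow_succ']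
  exact pow_apply_mem_cyclicSpan hAm e _

theorem form_eq_zero_of_mem_cyclicSpan [NeZero (2 : K)] (halt : ∀ u, ω u u = 0)
    (hA : ∀ u v, ω (A u) v = ω u (A v)) (m : ℕ) (e : U) {x y : U}
    (hx : x ∈ cyclicSpan A m e) (hy : y ∈ cyclicSpan A m e) : ω x y = 0 := by
  induction hx, hy using Submodule.span_induction₂ with
  | mem_mem x y hx hy =>
    obtain ⟨i, rfl⟩ := hx
    obtain ⟨j, rfl⟩ := hy
    exact form_pow_pow_self halt hA _ _ _
  | zero_left => simp
  | zero_right => simp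
  | add_left _ _ _ _ _ _ h₁ h₂ => simp [h₁, h₂]
  | add_right _ _ _ _ _ _ h₁ h₂ => simp [h₁, h₂]
  | smul_left _ _ _ _ _ h => simp [h]
  | smul_right _ _ _ _ _ h => simp [h]

theorem coeff_eq_zero_of_form_pow_eq_zero (hA : ∀ u v, ω (A u) v = ω u (A v)) {m : ℕ}
    (hAm : A ^ m = 0) {e f : U} (hef : ω ((A ^ (m - 1)) e) f ≠ 0) (c : Fin m → K)
    (hc : ∀ k : ℕ, ω (∑ i, c i • (A ^ (i : ℕ)) e) ((A ^ k) f) = 0) (i : Fin m) : c i = 0 := by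
  induction i using WellFoundedLT.induction with
  | ind i ih =>
    have h := hc (m - 1 - i)
    simp only [map_sum, map_smul, LinearMap.sum_apply, LinearMap.smul_apply, smul_eq_mul,
      form_pow_pow hA] at h
    rw [Finset.sum_eq_single i] at h
    · rw [show m - 1 - (i : ℕ) + i = m - 1 by omega] at h
      exact (mul_eq_zero.mp h).resolve_right hef
    · intro j _ hj
      rcases lt_or_gt_of_ne hj with hlt | hgt
      · simp [ih j hlt]
      · have hle : m ≤ m - 1 - (i : ℕ) + j := by
          have : (i : ℕ) < j := hgt
          omega
        simp [pow_eq_zero_of_le hle hAm]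
    · simp

theorem finrank_cyclicSpan (hA : ∀ u v, ω (A u) v = ω u (A v)) {m : ℕ}
    (hAm : A ^ m = 0) {e f : U} (hef : ω ((A ^ (m - 1)) e) f ≠ 0) :
    Module.finrank K (cyclicSpan A m e) = m := by
  have hli : LinearIndependent K fun i : Fin m => (A ^ (i : ℕ)) e :=
    Fintype.linearIndependent_iff.mpr fun c hc =>
      coeff_eq_zero_of_form_pow_eq_zero hA hAm hef c fun k => by simp [hc]
  exact (finrank_span_eq_card hli).trans (Fintype.card_fin m)

theorem disjoint_cyclicSpan [NeZero (2 : K)] (halt : ∀ u, ω u u = 0)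
    (hA : ∀ u v, ω (A u) v = ω u (A v)) {m : ℕ} (hAm : A ^ m = 0) {e f : U}
    (hef : ω ((A ^ (m - 1)) e) f ≠ 0) : Disjoint (cyclicSpan A m e) (cyclicSpan A m f) := by
  refine Submodule.disjoint_def.mpr fun x hxe hxf => ?_
  obtain ⟨c, rfl⟩ := (Submodule.mem_span_range_iff_exists_fun K).mp hxe
  have hc := coeff_eq_zero_of_form_pow_eq_zero hA hAm hef c fun k =>
    form_eq_zero_of_mem_cyclicSpan halt hA m f hxf (pow_apply_mem_cyclicSpan hAm f k)
  simp [hc]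

end SelfAdjoint

theorem stmt_15 (m : ℕ) (U : Type*) [AddCommGroup U] [Module ℂ U] [FiniteDimensional ℂ U]
    (hdim : Module.finrank ℂ U = 2 * m)
    (ω : U →ₗ[ℂ] U →ₗ[ℂ] ℂ)
    (halt : ∀ u, ω u u = 0)
    (hnd : ∀ u, (∀ v, ω u v = 0) → u = 0)
    (A : Module.End ℂ U)
    (hAsa : ∀ u v, ω (A u) v = ω u (A v))
    (hAnil : IsNilpotent A)
    -- `A` has exactly two Jordan blocks, each of size `m`:
    (hblocks : ∀ j : ℕ, j ≤ m →
      Module.finrank ℂ (LinearMap.range (A ^ j)) = 2 * (m - j)) :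
    ∃ Up Um : Submodule ℂ U,
      (∀ x ∈ Up, A x ∈ Up) ∧ (∀ x ∈ Um, A x ∈ Um) ∧
      -- `Up` and `Um` are Lagrangian
      Module.finrank ℂ Up = m ∧ Module.finrank ℂ Um = m ∧
      (∀ x ∈ Up, ∀ y ∈ Up, ω x y = 0) ∧
      (∀ x ∈ Um, ∀ y ∈ Um, ω x y = 0) ∧
      IsCompl Up Um := by
  have hAm : A ^ m = 0 := by
    have h := hblocks m le_rfl
    rw [Nat.sub_self, mul_zero, Submodule.finrank_eq_zero] at h
    exact LinearMap.range_eq_bot.mp h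
  rcases Nat.eq_zero_or_pos m with rfl | hm
  · have : Subsingleton U := Module.finrank_zero_iff.mp (by simpa using hdim)
    refine ⟨⊥, ⊤, ?_, ?_, ?_, ?_, ?_, ?_, isCompl_bot_top⟩ <;>
      simp [Subsingleton.elim _ (0 : U), hdim]
  obtain ⟨e, f, hef⟩ : ∃ e f, ω ((A ^ (m - 1)) e) f ≠ 0 := by
    by_contra! h
    have hzero : A ^ (m - 1) = 0 := LinearMap.ext fun u => hnd _ (h u)
    have hrank := hblocks (m - 1) (Nat.sub_le m 1)
    rw [hzero, LinearMap.range_zero, finrank_bot] at hrank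
    omega
  have hfe : ω ((A ^ (m - 1)) f) e ≠ 0 := by
    rw [form_pow_apply_left hAsa, ← LinearMap.IsAlt.neg (B := ω) halt]
    exact neg_ne_zero.mpr hef
  have he := finrank_cyclicSpan hAsa hAm hef
  have hf := finrank_cyclicSpan hAsa hAm hfe
  have hdisj := disjoint_cyclicSpan halt hAsa hAm hef
  refine ⟨cyclicSpan A m e, cyclicSpan A m f, fun _ => apply_mem_cyclicSpan hAm e,
    fun _ => apply_mem_cyclicSpan hAm f, he, hf,
    fun _ hx _ hy => form_eq_zero_of_mem_cyclicSpan halt hAsa m e hx hy,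
    fun _ hx _ hy => form_eq_zero_of_mem_cyclicSpan halt hAsa m f hx hy,
    hdisj, codisjoint_iff.mpr (Submodule.eq_top_of_disjoint _ _ ?_ hdisj)⟩
  rw [he, hf, hdim, two_mul]
end

section
/- Define χ : sl_n(ℂ) → ℂ^{n−1} by sending A to the tuple (c_0(A), …, c_{n−2}(A)) of coefficients of its characteristic polynomial det(t·I − A) = t^n + c_{n−2}(A) t^{n−2} + ⋯ + c_1(A) t + c_0(A) (the t^{n−1} coefficient vanishes since tr A = 0). Then for a nilpotent A ∈ sl_n(ℂ), the differential of χ at A is surjective if and only if A^{n−1} ≠ 0, i.e., if and only if A is a regular nilpotent. -/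
/-- The map `χ : M_n(ℂ) → ℂ^{n-1}` sending a matrix to the coefficients
`(c_0, …, c_{n-2})` of its characteristic polynomial
`det (t·I − A) = t^n + c_{n-2} t^{n-2} + ⋯ + c_1 t + c_0`. -/
noncomputable def charCoeffs (n : ℕ) (A : Matrix (Fin n) (Fin n) ℂ) : Fin (n - 1) → ℂ :=
  fun i => A.charpoly.coeff i

/-- The differential of `χ` at `A`, applied to `H`: the linear map
`H ↦ (d/ds)|_{s=0} χ(A + s H)`. -/
noncomputable def dCharCoeffs (n : ℕ) (A H : Matrix (Fin n) (Fin n) ℂ) : Fin (n - 1) → ℂ :=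
  fun i => deriv (fun s : ℂ => charCoeffs n (A + s • H) i) 0

open Polynomial in
theorem Matrix.charpolyRev_eq_one_of_isNilpotent {ι K : Type*} [Fintype ι] [DecidableEq ι]
    [Field K] {A : Matrix ι ι K} (hA : IsNilpotent A) : A.charpolyRev = 1 := by
  obtain ⟨c, -, hc⟩ := Polynomial.isUnit_iff.mp (Matrix.isUnit_charpolyRev_of_isNilpotent hA)
  have h := A.eval_charpolyRev
  rw [← hc, eval_C] at h
  rw [← hc, h, C_1]

theorem Matrix.charpoly_coeff_eq_charpolyRev_coeff {ι R : Type*} [Fintype ι] [DecidableEq ι]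
    [CommRing R] [Nontrivial R] (A : Matrix ι ι R) {k : ℕ} (hk : k ≤ Fintype.card ι) :
    A.charpoly.coeff k = A.charpolyRev.coeff (Fintype.card ι - k) := by
  rw [← Matrix.reverse_charpoly, Polynomial.coeff_reverse, Matrix.charpoly_natDegree_eq_dim,
    Polynomial.revAt_le (Nat.sub_le _ _), Nat.sub_sub_self hk]

open Polynomial in
/-- Factoring `1 - X (A + s H) = (1 - X A) (1 - s X (1 - X A)⁻¹ H)` for nilpotent `A` gives the
expansion of the reversed characteristic polynomial to first order in `s`. -/
theorem Matrix.exists_charpolyRev_add_smul_eq {ι K : Type*} [Fintype ι] [DecidableEq ι]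
    [Field K] {A : Matrix ι ι K} {n : ℕ} (hA : A ^ n = 0) (H : Matrix ι ι K) :
    ∃ Q : K[X][X], ∀ s : K, (A + s • H).charpolyRev =
      1 - (∑ k ∈ Finset.range n, C ((A ^ k * H).trace) * X ^ (k + 1)) * C s
        + Q.eval (C s) * C s ^ 2 := by
  set T : Matrix ι ι K[X] := (X : K[X]) • A.map C with hT
  set P : Matrix ι ι K[X] := ∑ k ∈ Finset.range n, T ^ k with hP
  have hpow (k : ℕ) : T ^ k = (X : K[X]) ^ k • (A ^ k).map C := by
    rw [hT, _root_.smul_pow, Matrix.map_pow]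
  have hTP : (1 - T) * P = 1 := by
    rw [hP, mul_neg_geom_sum, hpow, hA]
    simp
  have htr : (-((X : K[X]) • (P * H.map C))).trace =
      -∑ k ∈ Finset.range n, C ((A ^ k * H).trace) * X ^ (k + 1) := by
    rw [Matrix.trace_neg, Matrix.trace_smul, hP, Finset.sum_mul, Matrix.trace_sum,
      Finset.smul_sum]
    congr 1
    refine Finset.sum_congr rfl fun k _ => ?_
    rw [hpow, Matrix.smul_mul, Matrix.trace_smul, ← Matrix.map_mul,
      ← AddMonoidHom.map_trace (C : K →+* K[X])]
    simp only [smul_eq_mul]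
    ring
  refine ⟨(Matrix.det (1 + (X : K[X][X]) •
    (-((X : K[X]) • (P * H.map C))).map C)).divX.divX, fun s => ?_⟩
  have hfac : 1 - (X : K[X]) • (A + s • H).map C =
      (1 - T) * (1 + C s • (-((X : K[X]) • (P * H.map C)))) := by
    have hmap : (A + s • H).map C = A.map C + C s • H.map C := by
      ext i j : 2
      simp
    rw [mul_add, mul_one, Matrix.mul_smul, mul_neg, Matrix.mul_smul, ← mul_assoc, hTP, one_mul,
      hmap, smul_add, ← hT, smul_neg, smul_comm (C s)]
    abel
  rw [Matrix.charpolyRev, hfac, Matrix.det_mul, Matrix.det_one_add_smul, htr]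
  have h1 : (1 - T).det = 1 := Matrix.charpolyRev_eq_one_of_isNilpotent ⟨n, hA⟩
  rw [h1]
  ring

open Polynomial in
theorem Polynomial.differentiable_coeff_eval_C (Q : ℂ[X][X]) (m : ℕ) :
    Differentiable ℂ fun s : ℂ => (Q.eval (C s)).coeff m := by
  have h (s : ℂ) : (Q.eval (C s)).coeff m =
      ∑ j ∈ Finset.range (Q.natDegree + 1), (Q.coeff j).coeff m * s ^ j := by
    simp only [eval_eq_sum_range, finsetSum_coeff, ← C_pow, coeff_mul_C]
  simp only [h]
  fun_prop

open Polynomial in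
theorem dCharCoeffs_apply_of_pow_eq_zero {n : ℕ} {A : Matrix (Fin n) (Fin n) ℂ} (hA : A ^ n = 0)
    (H : Matrix (Fin n) (Fin n) ℂ) (i : Fin (n - 1)) :
    dCharCoeffs n A H i = -(A ^ (n - 1 - i) * H).trace := by
  obtain ⟨Q, hQ⟩ := Matrix.exists_charpolyRev_add_smul_eq hA H
  have hi := i.isLt
  obtain ⟨m, hm⟩ : ∃ m, n = i + (m + 1) := ⟨n - 1 - i, by omega⟩
  have hfun (s : ℂ) : charCoeffs n (A + s • H) i =
      -(A ^ (n - 1 - i) * H).trace * s + (Q.eval (C s)).coeff (m + 1) * s ^ 2 := by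
    have hm' : n - i = m + 1 := by omega
    have hm'' : n - 1 - i = m := by omega
    have hmn : m < n := by omega
    rw [charCoeffs, Matrix.charpoly_coeff_eq_charpolyRev_coeff _ (by simp; omega), hQ,
      Fintype.card_fin, hm', hm'', ← C_pow, coeff_add, coeff_sub, coeff_mul_C, coeff_mul_C,
      finsetSum_coeff]
    simp [coeff_one, coeff_X_pow, hmn]
  have hg := (Polynomial.differentiable_coeff_eval_C Q (m + 1) 0).hasDerivAt
  have hd := ((hasDerivAt_id (0 : ℂ)).const_mul (-(A ^ (n - 1 - i) * H).trace)).add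
    (hg.mul ((hasDerivAt_id (0 : ℂ)).pow 2))
  rw [dCharCoeffs, funext hfun]
  refine (hd.congr_deriv ?_).deriv
  simp

/-- If `A ^ n = 0` and `A ^ (n - 1) ≠ 0`, the traces of `A ^ k * H` for `k < n` can be
prescribed arbitrarily. -/
theorem Matrix.exists_trace_pow_mul_eq {ι K : Type*} [Fintype ι] [DecidableEq ι] [Field K]
    {A : Matrix ι ι K} {n : ℕ} (hA : A ^ n = 0) (hA' : A ^ (n - 1) ≠ 0) (c : ℕ → K) :
    ∃ H : Matrix ι ι K, ∀ k < n, (A ^ k * H).trace = c k := by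
  obtain ⟨B, hB⟩ : ∃ B : Matrix ι ι K, (A ^ (n - 1) * B).trace = 1 := by
    by_contra! h
    refine hA' (Matrix.ext_iff_trace_mul_right.mpr fun x => ?_)
    rw [Matrix.zero_mul, Matrix.trace_zero]
    by_contra hx
    refine h ((A ^ (n - 1) * x).trace⁻¹ • x) ?_
    rw [Matrix.mul_smul, Matrix.trace_smul, smul_eq_mul, inv_mul_cancel₀ hx]
  suffices ∀ m ≤ n, ∃ H : Matrix ι ι K, ∀ k < n, n ≤ k + m → (A ^ k * H).trace = c k by
    obtain ⟨H, hH⟩ := this n le_rfl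
    exact ⟨H, fun k hk => hH k hk (Nat.le_add_left _ _)⟩
  intro m hm
  induction m with
  | zero => exact ⟨0, fun k hk hk' => by omega⟩
  | succ m ih =>
    obtain ⟨H, hH⟩ := ih (by omega)
    refine ⟨H + (c (n - 1 - m) - (A ^ (n - 1 - m) * H).trace) • (A ^ m * B), fun k hk hkm => ?_⟩
    rw [mul_add, Matrix.trace_add, Matrix.mul_smul, Matrix.trace_smul, ← mul_assoc, ← pow_add]
    rcases Nat.lt_or_ge (k + m) n with h | h
    · obtain rfl : k = n - 1 - m := by omega
      rw [show n - 1 - m + m = n - 1 by omega, hB]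
      simp
    · rw [pow_eq_zero_of_le h hA, hH k hk h]
      simp

theorem stmt_17 (n : ℕ) (hn : 1 ≤ n) (A : Matrix (Fin n) (Fin n) ℂ)
    (htr : A.trace = 0) (hnil : A ^ n = 0) :
    Function.Surjective
        (fun H : {H : Matrix (Fin n) (Fin n) ℂ // H.trace = 0} =>
          dCharCoeffs n A H.1) ↔
      A ^ (n - 1) ≠ 0 := by
  constructor
  · intro hsurj hzero
    rcases hn.eq_or_lt with rfl | hn
    · simp at hzero
    · obtain ⟨H, hH⟩ := hsurj fun _ => 1
      have h := congrFun hH ⟨0, by omega⟩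
      simp [dCharCoeffs_apply_of_pow_eq_zero hnil, hzero] at h
  · intro hreg v
    obtain ⟨H, hH⟩ := Matrix.exists_trace_pow_mul_eq hnil hreg fun k =>
      if h : 0 < k ∧ k < n then -v ⟨n - 1 - k, by omega⟩ else 0
    refine ⟨⟨H, by simpa using hH 0 hn⟩, funext fun i => ?_⟩
    have hi := i.isLt
    have hpos : 0 < n - 1 - (i : ℕ) ∧ n - 1 - (i : ℕ) < n := by omega
    beta_reduce
    rw [dCharCoeffs_apply_of_pow_eq_zero hnil, hH _ hpos.2, dif_pos hpos, neg_neg]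
    congr 1
    ext
    simp only
    omega
end

section
/- Let A ∈ sl_n(ℂ) be nilpotent with A^{n−1} ≠ 0, and let χ : sl_n(ℂ) → ℂ^{n−1} send A to the coefficients (c_0, …, c_{n−2}) of its characteristic polynomial t^n + c_{n−2} t^{n−2} + ⋯ + c_0. Then the kernel of the differential d_Aχ equals {X A − A X : X ∈ M_n(ℂ)}, the tangent space at A to the conjugation orbit of A. -/
open Polynomial in
/-- The characteristic polynomial of a nilpotent matrix is `X ^ n`. -/
theorem Matrix.charpoly_eq_X_pow_of_isNilpotent {n : ℕ} {A : Matrix (Fin n) (Fin n) ℂ}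
    (hA : IsNilpotent A) : A.charpoly = X ^ n := by
  have h := Matrix.isNilpotent_charpoly_sub_pow_of_isNilpotent hA
  simpa [sub_eq_zero] using h.eq_zero

open Matrix in
/-- If `A ^ n = 0` and `A ^ (n - 1) v ≠ 0`, then `v, A v, …, A ^ (n - 1) v` are linearly
independent. -/
theorem Matrix.linearIndependent_pow_mulVec {n : ℕ} {A : Matrix (Fin n) (Fin n) ℂ}
    {v : Fin n → ℂ} (hnil : A ^ n = 0) (hv : A ^ (n - 1) *ᵥ v ≠ 0) :
    LinearIndependent ℂ (fun i : Fin n => A ^ (i : ℕ) *ᵥ v) := by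
  rw [Fintype.linearIndependent_iff]
  intro c hc i
  induction i using WellFoundedLT.induction with
  | ind i ih =>
    have h := congrArg (A ^ (n - 1 - (i : ℕ)) *ᵥ ·) hc
    simp only [Matrix.mulVec_sum, Matrix.mulVec_smul, Matrix.mulVec_mulVec, ← pow_add,
      Matrix.mulVec_zero] at h
    rw [Finset.sum_eq_single i] at h
    · rw [show n - 1 - (i : ℕ) + i = n - 1 by omega] at h
      exact (smul_eq_zero.1 h).resolve_right hv
    · intro j _ hj
      rcases lt_or_gt_of_ne hj with hj | hj
      · rw [ih j hj, zero_smul]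
      · rw [pow_eq_zero_of_le (by have := Fin.lt_def.1 hj; omega) hnil, Matrix.zero_mulVec,
          smul_zero]
    · simp

open Matrix in
/-- The commutant of a regular nilpotent matrix consists of polynomials in that matrix. -/
theorem Matrix.exists_eq_sum_pow_of_commute {n : ℕ} {A B : Matrix (Fin n) (Fin n) ℂ}
    (hnil : A ^ n = 0) (hreg : A ^ (n - 1) ≠ 0) (hAB : Commute A B) :
    ∃ c : Fin n → ℂ, B = ∑ k, c k • A ^ (k : ℕ) := by
  obtain ⟨v, hv⟩ : ∃ v, A ^ (n - 1) *ᵥ v ≠ 0 := by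
    by_contra h
    push Not at h
    exact hreg (Matrix.ext_of_mulVec_single fun i => by
      rw [h, Matrix.zero_mulVec])
  have hli := Matrix.linearIndependent_pow_mulVec hnil hv
  have hspan : Submodule.span ℂ (Set.range fun i : Fin n => A ^ (i : ℕ) *ᵥ v) = ⊤ :=
    hli.span_eq_top_of_card_eq_finrank' (by simp)
  have hB : B *ᵥ v ∈ Submodule.span ℂ (Set.range fun i : Fin n => A ^ (i : ℕ) *ᵥ v) :=
    hspan ▸ Submodule.mem_top
  obtain ⟨c, hc⟩ := (Submodule.mem_span_range_iff_exists_fun ℂ).1 hB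
  refine ⟨c, Matrix.toLin'.injective (LinearMap.ext_on_range hspan fun i => ?_)⟩
  have hcomm : Commute (A ^ (i : ℕ)) (∑ k, c k • A ^ (k : ℕ)) :=
    Commute.sum_right _ _ _ fun k _ => (Commute.pow_pow_self A _ _).smul_right _
  rw [Matrix.toLin'_apply, Matrix.toLin'_apply, Matrix.mulVec_mulVec, Matrix.mulVec_mulVec,
    ← (hAB.pow_left i).eq, ← hcomm.eq, ← Matrix.mulVec_mulVec, ← Matrix.mulVec_mulVec, ← hc,
    Matrix.sum_mulVec]
  simp [Matrix.smul_mulVec]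

/-- A matrix which is trace-orthogonal to the commutant of `A` is a commutator with `A`. -/
theorem Matrix.exists_eq_commutator_of_trace_eq_zero {m : Type*} [Fintype m] [DecidableEq m]
    {A H : Matrix m m ℂ} (h : ∀ B, Commute A B → (B * H).trace = 0) :
    ∃ X : Matrix m m ℂ, H = X * A - A * X := by
  let ad : Matrix m m ℂ →ₗ[ℂ] Matrix m m ℂ :=
    LinearMap.mulRight ℂ A - LinearMap.mulLeft ℂ A
  suffices hH : H ∈ LinearMap.range ad by
    obtain ⟨X, hX⟩ := hH
    exact ⟨X, by simpa [ad] using hX.symm⟩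
  by_contra hH
  obtain ⟨f, hf, hf'⟩ := Submodule.exists_dual_map_eq_bot_of_notMem hH inferInstance
  let B : Matrix m m ℂ := Matrix.of fun i j => f (Matrix.single j i 1)
  have hB (M : Matrix m m ℂ) : f M = (B * M).trace := by
    conv_lhs => rw [Matrix.matrix_eq_sum_single M]
    simp only [map_sum, Matrix.trace, Matrix.diag, Matrix.mul_apply, B, Matrix.of_apply]
    rw [Finset.sum_comm]
    refine Finset.sum_congr rfl fun i _ => Finset.sum_congr rfl fun j _ => ?_
    rw [← mul_one (M j i), ← smul_eq_mul (M j i) 1, ← Matrix.smul_single, map_smul]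
    simp [mul_comm]
  refine hf ((hB H).trans (h B ?_))
  refine Matrix.ext_iff_trace_mul_right.2 fun X => ?_
  have hX : f (ad X) = 0 := by
    have : f (ad X) ∈ (LinearMap.range ad).map f := ⟨_, ⟨X, rfl⟩, rfl⟩
    simpa [hf'] using this
  rw [hB] at hX
  simp only [ad, LinearMap.sub_apply, LinearMap.mulRight_apply, LinearMap.mulLeft_apply, mul_sub,
    Matrix.trace_sub, sub_eq_zero] at hX
  rw [Matrix.mul_assoc B A X, ← hX, ← Matrix.mul_assoc B X A,
    Matrix.trace_mul_comm (B * X) A, Matrix.mul_assoc]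

open Polynomial in
/-- The coefficients of the characteristic polynomial are differentiable along lines. -/
theorem Matrix.differentiable_charpoly_coeff_add_smul {m : Type*} [Fintype m] [DecidableEq m]
    (A H : Matrix m m ℂ) (i : ℕ) :
    Differentiable ℂ fun s : ℂ => (A + s • H).charpoly.coeff i := by
  have h (s : ℂ) : (A + s • H).charpoly.coeff i =
      (((A.map C + (X : ℂ[X]) • H.map C).charpoly).coeff i).eval s := by
    have hs : A + s • H = (A.map C + (X : ℂ[X]) • H.map C).map (evalRingHom s) := by
      ext i j
      simp [mul_comm s]
    rw [hs, Matrix.charpoly_map, coeff_map, coe_evalRingHom]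
  simp only [h]
  exact Polynomial.differentiable _

/-- Jacobi's formula for the characteristic polynomial at a nilpotent matrix, at `t ≠ 0`. -/
theorem Matrix.hasDerivAt_eval_charpoly {n : ℕ} {A : Matrix (Fin n) (Fin n) ℂ} (hnil : A ^ n = 0)
    (H : Matrix (Fin n) (Fin n) ℂ) {t : ℂ} (ht : t ≠ 0) :
    HasDerivAt (fun s : ℂ => (A + s • H).charpoly.eval t)
      (-∑ j ∈ Finset.range n, (A ^ (n - 1 - j) * H).trace * t ^ j) 0 := by
  set S : Matrix (Fin n) (Fin n) ℂ := Matrix.scalar (Fin n) t with hS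
  set N := ∑ j ∈ Finset.range n, S ^ j * A ^ (n - 1 - j) with hN
  have hdet : (S - A).det = t ^ n := by
    rw [← Matrix.eval_charpoly, Matrix.charpoly_eq_X_pow_of_isNilpotent ⟨n, hnil⟩]
    simp
  have hSN : (S - A) * N = t ^ n • (1 : Matrix (Fin n) (Fin n) ℂ) := by
    have hc : Commute S A := Matrix.scalar_commute t (fun _ => mul_comm _ _) A
    rw [hN, hc.mul_geom_sum₂, hnil, sub_zero, hS, ← map_pow, Matrix.scalar_apply,
      Matrix.smul_one_eq_diagonal]
  have htr : (N * H).trace = ∑ j ∈ Finset.range n, (A ^ (n - 1 - j) * H).trace * t ^ j := by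
    rw [hN, Finset.sum_mul, Matrix.trace_sum]
    refine Finset.sum_congr rfl fun j _ => ?_
    rw [hS, ← map_pow, Matrix.scalar_apply, ← Matrix.smul_one_eq_diagonal, smul_mul_assoc, one_mul,
      smul_mul_assoc, Matrix.trace_smul, smul_eq_mul, mul_comm]
  set K := -((t ^ n)⁻¹ • (N * H)) with hK
  have hfac (s : ℂ) : (A + s • H).charpoly.eval t = t ^ n * (1 + s • K).det := by
    rw [Matrix.eval_charpoly, ← hdet, ← Matrix.det_mul]
    congr 1
    have : (S - A) * K = -H := by
      rw [hK, mul_neg, mul_smul_comm, ← mul_assoc, hSN, smul_mul_assoc, one_mul,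
        inv_smul_smul₀ (pow_ne_zero _ ht)]
    rw [mul_add, mul_one, mul_smul_comm, this, ← hS, smul_neg]
    abel
  rw [funext fun s => (hfac s).trans (congrArg _ (Matrix.det_one_add_smul s K)),
    ← htr]
  have hKtr : t ^ n * K.trace = -(N * H).trace := by
    rw [hK, Matrix.trace_neg, Matrix.trace_smul, smul_eq_mul, mul_neg,
      mul_inv_cancel_left₀ (pow_ne_zero _ ht)]
  rw [← hKtr]
  set q := (Matrix.det (1 + (Polynomial.X : Polynomial ℂ) • K.map Polynomial.C)).divX.divX
  have h1 : HasDerivAt (fun s : ℂ => 1 + K.trace * s) K.trace 0 := by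
    simpa using ((hasDerivAt_id (0 : ℂ)).const_mul K.trace).const_add 1
  have h2 := (q.hasDerivAt 0).mul ((hasDerivAt_id (0 : ℂ)).pow 2)
  simpa using (h1.add h2).const_mul (t ^ n)

/-- At a nilpotent matrix `A`, the derivative of the `i`-th coefficient of the characteristic
polynomial in the direction `H` is `-tr (A ^ (n - 1 - i) H)`. -/
theorem Matrix.deriv_charpoly_coeff {n : ℕ} {A : Matrix (Fin n) (Fin n) ℂ} (hnil : A ^ n = 0)
    (H : Matrix (Fin n) (Fin n) ℂ) {i : ℕ} (hi : i < n) :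
    deriv (fun s : ℂ => (A + s • H).charpoly.coeff i) 0 = -(A ^ (n - 1 - i) * H).trace := by
  set d : ℕ → ℂ := fun j => deriv (fun s : ℂ => (A + s • H).charpoly.coeff j) 0 with hd
  let P : Polynomial ℂ := ∑ j ∈ Finset.range (n + 1), Polynomial.monomial j (d j)
  let Q : Polynomial ℂ :=
    -∑ j ∈ Finset.range n, Polynomial.monomial j (A ^ (n - 1 - j) * H).trace
  have hPQ : P = Q := by
    refine Polynomial.eq_of_infinite_eval_eq P Q
      ((Set.finite_singleton (0 : ℂ)).infinite_compl.mono fun t ht => ?_)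
    have h1 := Matrix.hasDerivAt_eval_charpoly hnil H (t := t) ht
    have h2 : HasDerivAt (fun s : ℂ => (A + s • H).charpoly.eval t)
        (∑ j ∈ Finset.range (n + 1), d j * t ^ j) 0 := by
      have he (s : ℂ) : (A + s • H).charpoly.eval t =
          ∑ j ∈ Finset.range (n + 1), (A + s • H).charpoly.coeff j * t ^ j := by
        rw [Polynomial.eval_eq_sum_range, Matrix.charpoly_natDegree_eq_dim, Fintype.card_fin]
      simp only [he]
      exact HasDerivAt.fun_sum fun j _ =>
        ((Matrix.differentiable_charpoly_coeff_add_smul A H j 0).hasDerivAt).mul_const _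
    simpa [P, Q, Polynomial.eval_finsetSum] using h2.unique h1
  have hc := congrArg (Polynomial.coeff · i) hPQ
  simpa [P, Q, Polynomial.coeff_monomial, hi, hi.trans (Nat.lt_succ_self n)] using hc

theorem stmt_18 (n : ℕ) (hn : 1 ≤ n) (A : Matrix (Fin n) (Fin n) ℂ)
    (htr : A.trace = 0) (hnil : A ^ n = 0) (hreg : A ^ (n - 1) ≠ 0) :
    {H : Matrix (Fin n) (Fin n) ℂ | H.trace = 0 ∧ dCharCoeffs n A H = 0} =
      {C : Matrix (Fin n) (Fin n) ℂ |
        ∃ X : Matrix (Fin n) (Fin n) ℂ, C = X * A - A * X} := by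
  have hd (H : Matrix (Fin n) (Fin n) ℂ) (i : Fin (n - 1)) :
      dCharCoeffs n A H i = -(A ^ (n - 1 - (i : ℕ)) * H).trace :=
    Matrix.deriv_charpoly_coeff hnil H (by omega)
  ext H
  constructor
  · rintro ⟨hH, hdH⟩
    refine Matrix.exists_eq_commutator_of_trace_eq_zero fun B hAB => ?_
    obtain ⟨c, rfl⟩ := Matrix.exists_eq_sum_pow_of_commute hnil hreg hAB
    rw [Finset.sum_mul, Matrix.trace_sum]
    refine Finset.sum_eq_zero fun k _ => ?_
    rw [smul_mul_assoc, Matrix.trace_smul]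
    rcases Nat.eq_zero_or_pos (k : ℕ) with hk | hk
    · simp [hk, hH]
    · have h := hd H ⟨n - 1 - k, by omega⟩
      rw [hdH, show n - 1 - (n - 1 - (k : ℕ)) = k by omega] at h
      rw [neg_eq_zero.1 h.symm, smul_zero]
  · rintro ⟨X, rfl⟩
    have h (k : ℕ) : (A ^ k * (X * A - A * X)).trace = 0 := by
      rw [mul_sub, Matrix.trace_sub, ← mul_assoc, Matrix.trace_mul_comm, ← mul_assoc, ← mul_assoc,
        ← pow_succ, ← pow_succ', sub_self]
    exact ⟨by simpa using h 0, funext fun i => by rw [hd, h]; simp⟩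
end
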